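/- arXiv:math/0410303 — 2 statements merged into one kernel-verified Lean document; each statement's English description precedes it below -/
import Mathlib

section
/- Let (R, m) be a commutative Noetherian local ring, I an ideal, and M, N finitely generated R-modules with Supp(N) ∩ Supp(M) ∩ V(I) = {m}. Then for every i ≥ 0, both Tor_i^R(N/I^n N, M) and Ext_R^i(M, N/I^n N) have finite length for all n ≥ 1, and there exist polynomials p_i and q_i with rational coefficients such that λ(Tor_i^R(N/I^n N, M)) = p_i(n) and λ(Ext_R^i(M, N/I^n N)) = q_i(n) for all sufficiently large n. -/
set_option synthInstance.maxHeartbeats 1000000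

open CategoryTheory

universe u

/-- The length `λ(M)` of a module `M`, realized as the Krull dimension of the lattice of
submodules of `M`. -/
noncomputable def moduleLength (R M : Type*) [Ring R] [AddCommGroup M] [Module R M] :
    WithBot ℕ∞ :=
  Order.krullDim (Submodule R M)

/-- `Tor_i^R(A, B)`, as an `R`-module. -/
noncomputable abbrev torModule (R : Type u) [CommRing R] (i : ℕ) (A B : Type u)
    [AddCommGroup A] [Module R A] [AddCommGroup B] [Module R B] : Type u :=
  ↥(((Tor (ModuleCat.{u} R) i).obj (ModuleCat.of R A)).obj (ModuleCat.of R B))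

/-- `Ext_R^i(A, B)`, as an `R`-module. -/
noncomputable abbrev extModule (R : Type u) [CommRing R] (i : ℕ) (A B : Type u)
    [AddCommGroup A] [Module R A] [AddCommGroup B] [Module R B] : Type u :=
  ↥(((Ext R (ModuleCat.{u} R) i).obj (Opposite.op (ModuleCat.of R A))).obj (ModuleCat.of R B))

namespace FGModuleCat
variable {R : Type u} [CommRing R] [IsNoetherianRing R]

theorem projective_of (P : FGModuleCat.{u} R) [Module.Projective R P] : Projective P where
  factors {E X} f e _ := by
    have : Projective ((forget₂ (FGModuleCat R) (ModuleCat R)).obj P) :=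
      (IsProjective.iff_projective (R := R) P).1 ‹_›
    refine ⟨(forget₂ (FGModuleCat R) (ModuleCat R)).preimage (Projective.factorThru
      ((forget₂ (FGModuleCat R) (ModuleCat R)).map f)
      ((forget₂ (FGModuleCat R) (ModuleCat R)).map e)), ?_⟩
    apply (forget₂ (FGModuleCat R) (ModuleCat R)).map_injective
    simp

theorem exists_free_cover (X : FGModuleCat.{u} R) : ∃ (P : FGModuleCat.{u} R) (f : P ⟶ X),
    Module.Projective R P ∧ Epi f := by
  obtain ⟨n, f, hf⟩ := Module.Finite.exists_fin' R X
  let e : ULift.{u} (Fin n) ≃ Fin n := Equiv.ulift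
  let g : (ULift.{u} (Fin n) → R) →ₗ[R] X := f ∘ₗ (LinearEquiv.funCongrLeft R R e.symm).toLinearMap
  have hg : Function.Surjective g := hf.comp (LinearEquiv.surjective _)
  refine ⟨FGModuleCat.of R (ULift.{u} (Fin n) → R), FGModuleCat.ofHom g, ?_, ?_⟩
  · change Module.Projective R (ULift.{u} (Fin n) → R)
    infer_instance
  · have : Epi ((forget₂ (FGModuleCat R) (ModuleCat R)).map (FGModuleCat.ofHom g)) :=
      (ModuleCat.epi_iff_surjective _).2 hg
    exact (forget₂ (FGModuleCat R) (ModuleCat R)).epi_of_epi_map this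

instance : EnoughProjectives (FGModuleCat.{u} R) where
  presentation X := by
    obtain ⟨P, f, hP, hf⟩ := exists_free_cover X
    have := projective_of P
    exact ⟨ProjectivePresentation.mk P f⟩

instance : (forget₂ (FGModuleCat.{u} R) (ModuleCat.{u} R)).PreservesProjectiveObjects where
  projective_obj {X} hX := by
    obtain ⟨P, f, hP, hf⟩ := exists_free_cover X
    have : Projective ((forget₂ (FGModuleCat R) (ModuleCat R)).obj P) :=
      (IsProjective.iff_projective (R := R) P).1 ‹_›
    have r : Retract X P := ⟨Projective.factorThru (𝟙 X) f, f, by simp⟩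
    exact (r.map (forget₂ (FGModuleCat R) (ModuleCat R))).projective

end FGModuleCat

theorem exists_finite_projectiveResolution {R : Type u} [CommRing R] [IsNoetherianRing R]
    (M : Type u) [AddCommGroup M] [Module R M] [Module.Finite R M] :
    ∃ P : ProjectiveResolution (ModuleCat.of R M), ∀ i, Module.Finite R (P.complex.X i) := by
  let P := (forget₂ (FGModuleCat R) (ModuleCat R)).mapProjectiveResolution
    (projectiveResolution (FGModuleCat.of R M))
  refine ⟨P, fun i ↦ ?_⟩
  change Module.Finite R ((projectiveResolution (FGModuleCat.of R M)).complex.X i)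
  infer_instance

/-- A sequence of natural numbers is eventually polynomial if it agrees with a polynomial with
rational coefficients for all large arguments. -/
def EventuallyPolynomial (a : ℕ → ℕ) : Prop :=
  ∃ (p : Polynomial ℚ) (N₀ : ℕ), ∀ n ≥ N₀, (a n : ℚ) = p.eval (n : ℚ)

theorem Polynomial.exists_comp_one_add_X_sub_eq (q : Polynomial ℚ) :
    ∃ p : Polynomial ℚ, p.comp (1 + X) - p = q := by
  induction q using Polynomial.induction_on' with
  | add q₁ q₂ h₁ h₂ =>
    obtain ⟨p₁, rfl⟩ := h₁
    obtain ⟨p₂, rfl⟩ := h₂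
    exact ⟨p₁ + p₂, by simp only [add_comp]; ring⟩
  | monomial n a =>
    refine ⟨C (a / (n + 1)) * bernoulli (n + 1), ?_⟩
    rw [mul_comp, C_comp, Polynomial.bernoulli_comp_one_add_X, ← mul_sub, add_sub_cancel_left,
      ← C_mul_X_pow_eq_monomial, nsmul_eq_mul, ← C_eq_natCast, ← mul_assoc, ← C_mul]
    congr 2
    push_cast
    field_simp

theorem EventuallyPolynomial.congr {a b : ℕ → ℕ} (hb : EventuallyPolynomial b)
    (h : ∃ N₀, ∀ n ≥ N₀, a n = b n) : EventuallyPolynomial a := by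
  obtain ⟨p, N, hp⟩ := hb
  obtain ⟨N', h⟩ := h
  refine ⟨p, max N N', fun n hn ↦ ?_⟩
  rw [h n (le_of_max_le_right hn), hp n (le_of_max_le_left hn)]

theorem EventuallyPolynomial.add {a b : ℕ → ℕ} (ha : EventuallyPolynomial a)
    (hb : EventuallyPolynomial b) : EventuallyPolynomial (fun n ↦ a n + b n) := by
  obtain ⟨p, N, hp⟩ := ha
  obtain ⟨q, N', hq⟩ := hb
  refine ⟨p + q, max N N', fun n hn ↦ ?_⟩
  push_cast
  rw [hp n (le_of_max_le_left hn), hq n (le_of_max_le_right hn), Polynomial.eval_add]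

/-- If `a (n + 1) - a n = b n - c n` for large `n` with `b` and `c` eventually polynomial, then `a`
is eventually polynomial. -/
theorem EventuallyPolynomial.of_add_eq_add {a b c : ℕ → ℕ} (hb : EventuallyPolynomial b)
    (hc : EventuallyPolynomial c) (h : ∃ N₀, ∀ n ≥ N₀, a (n + 1) + c n = a n + b n) :
    EventuallyPolynomial a := by
  obtain ⟨q, N, hq⟩ := hb
  obtain ⟨r, N', hr⟩ := hc
  obtain ⟨N'', h⟩ := h
  obtain ⟨p, hp⟩ := (q - r).exists_comp_one_add_X_sub_eq
  let m := N + N' + N''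
  refine ⟨p + Polynomial.C (a m - p.eval (m : ℚ)), m, fun n hn ↦ ?_⟩
  induction n, hn using Nat.le_induction with
  | base => simp
  | succ n hn ih =>
    have h1 : (a (n + 1) : ℚ) + c n = a n + b n := mod_cast h n (by omega)
    rw [hq n (by omega), hr n (by omega), ih] at h1
    have h2 := congr_arg (Polynomial.eval (n : ℚ)) hp
    simp only [Polynomial.eval_sub, Polynomial.eval_comp, Polynomial.eval_add, Polynomial.eval_one,
      Polynomial.eval_X, Polynomial.eval_C] at h1 h2 ⊢
    push_cast
    rw [add_comm (n : ℚ) 1]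
    linarith

section Length

variable {R A B : Type*} [CommRing R] [AddCommGroup A] [Module R A] [AddCommGroup B] [Module R B]

theorem Module.length_add_length_ker (f : A →ₗ[R] B) :
    Module.length R B + Module.length R (LinearMap.ker f) =
      Module.length R A + Module.length R (B ⧸ LinearMap.range f) := by
  rw [Module.length_eq_add_of_exact (LinearMap.range f).subtype (LinearMap.range f).mkQ
      (Submodule.subtype_injective _) (Submodule.mkQ_surjective _) (LinearMap.exact_subtype_mkQ _),
    Module.length_eq_add_of_exact (LinearMap.ker f).subtype f.rangeRestrict
      (Submodule.subtype_injective _) f.surjective_rangeRestrict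
      (LinearMap.exact_iff.2 (by simp))]
  ring

theorem IsFiniteLength.length_ne_top (h : IsFiniteLength R A) : Module.length R A ≠ ⊤ :=
  Module.length_ne_top_iff.2 h

theorem IsFiniteLength.toNat_length_add_toNat_length_ker (hA : IsFiniteLength R A)
    (hB : IsFiniteLength R B) (f : A →ₗ[R] B) :
    (Module.length R B).toNat + (Module.length R (LinearMap.ker f)).toNat =
      (Module.length R A).toNat + (Module.length R (B ⧸ LinearMap.range f)).toNat := by
  rw [← ENat.toNat_add hB.length_ne_top
      (hA.of_injective (Submodule.subtype_injective _)).length_ne_top,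
    Module.length_add_length_ker f, ENat.toNat_add hA.length_ne_top
      (hB.of_surjective (Submodule.mkQ_surjective _)).length_ne_top]

end Length

/-- The Hilbert–Serre theorem for a sequence of modules of finite length, acted on by commuting
operators of degree one, all of whose graded submodules are eventually generated by the
operators. -/
theorem eventuallyPolynomial_length_of_operators {R : Type*} [CommRing R] (r : ℕ) :
    ∀ (M : ℕ → Type u) [∀ n, AddCommGroup (M n)] [∀ n, Module R (M n)]
      (x : Fin r → ∀ n, M n →ₗ[R] M (n + 1)),
      (∀ i j n m, x i (n + 1) (x j n m) = x j (n + 1) (x i n m)) →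
      (∃ N₀, ∀ n ≥ N₀, IsFiniteLength R (M n)) →
      (∀ L : ∀ n, Submodule R (M n), (∀ j n, (L n).map (x j n) ≤ L (n + 1)) →
        ∃ N₀, ∀ n ≥ N₀, L (n + 1) ≤ ⨆ j, (L n).map (x j n)) →
      EventuallyPolynomial (fun n ↦ (Module.length R (M n)).toNat) := by
  induction r with
  | zero =>
    intro M _ _ x _ _ hN
    obtain ⟨N, hN⟩ := hN (fun _ ↦ ⊤) (fun j ↦ j.elim0)
    refine ⟨0, N + 1, fun n hn ↦ ?_⟩
    obtain ⟨n, rfl⟩ : ∃ k, n = k + 1 := ⟨n - 1, by omega⟩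
    have := hN n (by omega)
    rw [iSup_of_empty, top_le_iff, subsingleton_iff_bot_eq_top,
      Submodule.subsingleton_iff] at this
    simp [Module.length_eq_zero]
  | succ r ih =>
    intro M _ _ x hx hfin hN
    obtain ⟨N₀, hfin⟩ := hfin
    refine EventuallyPolynomial.of_add_eq_add
      (b := fun n ↦ (Module.length R (M (n + 1) ⧸ LinearMap.range (x 0 n))).toNat)
      (c := fun n ↦ (Module.length R (LinearMap.ker (x 0 n))).toNat) ?_ ?_
      ⟨N₀, fun n hn ↦ (hfin n hn).toNat_length_add_toNat_length_ker (hfin (n + 1) (by omega)) _⟩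
    · refine ih (fun n ↦ M (n + 1) ⧸ LinearMap.range (x 0 n))
        (fun j n ↦ Submodule.mapQ _ _ (x j.succ (n + 1)) ?_) ?_
        ⟨N₀, fun n hn ↦ (hfin (n + 1) (by omega)).of_surjective (Submodule.mkQ_surjective _)⟩ ?_
      · rintro _ ⟨m, rfl⟩
        exact ⟨x j.succ n m, hx _ _ _ _⟩
      · intro i j n m
        obtain ⟨m, rfl⟩ := Submodule.mkQ_surjective _ m
        simp [hx i.succ j.succ]
      · intro L hL
        let L' : ∀ n, Submodule R (M n) := fun n ↦ match n with
          | 0 => ⊥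
          | n + 1 => (L n).comap (LinearMap.range (x 0 n)).mkQ
        have hmem : ∀ n m, x 0 n m ∈ L' (n + 1) := fun n m ↦ by
          simp [L', (Submodule.Quotient.mk_eq_zero (LinearMap.range (x 0 n))).2 ⟨m, rfl⟩]
        obtain ⟨N₁, hN₁⟩ := hN L' (by
          intro j n
          rw [Submodule.map_le_iff_le_comap]
          intro m hm
          induction j using Fin.cases with
          | zero => exact hmem n m
          | succ j =>
            cases n with
            | zero => simp [show m = 0 from hm]
            | succ n => exact hL j n ⟨_, hm, rfl⟩)
        refine ⟨N₁, fun n hn ↦ ?_⟩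
        have key : L' (n + 2) ≤ (⨆ j, (L n).map (Submodule.mapQ _ _ (x (Fin.succ j) (n + 1)) (by
            rintro _ ⟨m, rfl⟩
            exact ⟨x j.succ n m, hx _ _ _ _⟩))).comap (LinearMap.range (x 0 (n + 1))).mkQ := by
          refine (hN₁ (n + 1) (by omega)).trans (iSup_le fun j ↦ ?_)
          rw [Submodule.map_le_iff_le_comap]
          intro m hm
          induction j using Fin.cases with
          | zero =>
            simp [(Submodule.Quotient.mk_eq_zero (LinearMap.range (x 0 (n + 1)))).2 ⟨m, rfl⟩]
          | succ j => exact Submodule.mem_iSup_of_mem j ⟨_, hm, rfl⟩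
        intro m hm
        obtain ⟨m, rfl⟩ := Submodule.mkQ_surjective _ m
        exact key hm
    · refine ih (fun n ↦ LinearMap.ker (x 0 n))
        (fun j n ↦ (x j.succ n).restrict fun m hm ↦ ?_) ?_
        ⟨N₀, fun n hn ↦ (hfin n hn).of_injective (Submodule.subtype_injective _)⟩ ?_
      · rw [LinearMap.mem_ker] at hm ⊢
        rw [hx, hm, map_zero]
      · intro i j n m
        exact Subtype.ext (hx _ _ _ _)
      · intro L hL
        obtain ⟨N₁, hN₁⟩ := hN (fun n ↦ (L n).map (LinearMap.ker (x 0 n)).subtype) (by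
          rintro j n _ ⟨_, ⟨m, hm, rfl⟩, rfl⟩
          induction j using Fin.cases with
          | zero => rw [Submodule.subtype_apply, LinearMap.mem_ker.1 m.2]; exact zero_mem _
          | succ j => exact ⟨_, hL j n ⟨m, hm, rfl⟩, rfl⟩)
        refine ⟨N₁, fun n hn ↦ ?_⟩
        rw [← Submodule.map_le_map_iff_of_injective (Submodule.subtype_injective _),
          Submodule.map_iSup]
        refine (hN₁ n hn).trans (iSup_le fun j ↦ ?_)
        rintro _ ⟨_, ⟨m, hm, rfl⟩, rfl⟩
        induction j using Fin.cases with
        | zero => rw [Submodule.subtype_apply, LinearMap.mem_ker.1 m.2]; exact zero_mem _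
        | succ j => exact Submodule.mem_iSup_of_mem j ⟨_, ⟨m, hm, rfl⟩, rfl⟩

section ArtinRees

variable {R B : Type*} [CommRing R] [AddCommGroup B] [Module R B]

/-- The submodule over the Rees algebra of `I` attached to a sequence of submodules `L n` with
`I • L n ≤ L (n + 1)`, which need not be decreasing. -/
def reesSubmodule (I : Ideal R) (L : ℕ → Submodule R B) (hI : ∀ n, I • L n ≤ L (n + 1)) :
    Submodule (reesAlgebra I) (PolynomialModule R B) where
  carrier := {f | ∀ i, f.coeff i ∈ L i}
  add_mem' hf hg i := Submodule.add_mem _ (hf i) (hg i)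
  zero_mem' _ := Submodule.zero_mem _
  smul_mem' r f hf i := by
    rw [Subalgebra.smul_def, PolynomialModule.smul_apply]
    refine Submodule.sum_mem _ fun ⟨j, k⟩ e ↦ ?_
    obtain rfl : j + k = i := Finset.HasAntidiagonal.mem_antidiagonal.1 e
    have hpow : ∀ j k, I ^ j • L k ≤ L (j + k) := fun j k ↦ by
      induction j with
      | zero => simp
      | succ j ih =>
        rw [pow_succ', Submodule.mul_smul, Nat.succ_add]
        exact (Submodule.smul_mono le_rfl ih).trans (hI _)
    exact hpow j k (Submodule.smul_mem_smul (r.2 j) (hf k))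

/-- A form of the Artin–Rees lemma: a graded submodule of `⨁ Iⁿ D` is generated in bounded
degrees. -/
theorem Ideal.exists_forall_eq_smul_of_le_pow_smul [IsNoetherianRing R] [Module.Finite R B]
    (I : Ideal R) (D : Submodule R B) (L : ℕ → Submodule R B) (hD : ∀ n, L n ≤ I ^ n • D)
    (hI : ∀ n, I • L n ≤ L (n + 1)) : ∃ N₀, ∀ n ≥ N₀, L (n + 1) = I • L n := by
  have hfg : (reesSubmodule I L hI).FG := by
    have h := (Ideal.Filtration.submodule_fg_iff_stable (I.stableFiltration D)
      fun _ ↦ IsNoetherian.noetherian _).2 (I.stableFiltration_stable D)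
    have := isNoetherian_of_fg_of_noetherian _ h
    rw [isNoetherian_submodule] at this
    exact this _ fun f hf i ↦ hD i (hf i)
  obtain ⟨s, hs⟩ := hfg
  let N := s.sup fun f ↦ f.coeff.support.sup id
  refine ⟨N, fun n hn ↦ le_antisymm (fun m hm ↦ ?_) (hI n)⟩
  let T : Submodule (reesAlgebra I) (PolynomialModule R B) := reesSubmodule I
    (fun k ↦ if k ≤ n then L k else I • L (k - 1)) (by
      intro k
      split_ifs with h1 h2 h2
      · exact hI k
      · rfl
      · omega
      · obtain ⟨k, rfl⟩ : ∃ l, k = l + 1 := ⟨k - 1, by omega⟩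
        exact Submodule.smul_mono le_rfl (hI k))
  have hT : reesSubmodule I L hI ≤ T := by
    rw [← hs, Submodule.span_le]
    intro f hf i
    by_cases hi : f.coeff i = 0
    · rw [hi]; exact zero_mem _
    · have hiN : i ≤ N := (Finset.le_sup (f := id) (Finsupp.mem_support_iff.2 hi)).trans
        (Finset.le_sup (f := fun f : PolynomialModule R B ↦ f.coeff.support.sup id) hf)
      have : f ∈ reesSubmodule I L hI := hs ▸ Submodule.subset_span hf
      simpa [if_pos (hiN.trans hn)] using this i
  have hsingle : PolynomialModule.single R (n + 1) m ∈ reesSubmodule I L hI := by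
    intro i
    rw [PolynomialModule.coeff_single, Finsupp.single_apply]
    split_ifs with h
    · exact h ▸ hm
    · exact zero_mem _
  simpa [PolynomialModule.coeff_single] using hT hsingle (n + 1)

/-- Subquotient form of the Artin–Rees lemma. -/
theorem Ideal.exists_forall_le_smul_sup [IsNoetherianRing R] [Module.Finite R B]
    (I : Ideal R) (P Q L : ℕ → Submodule R B) (hQ : ∀ n, I • Q n ≤ Q (n + 1))
    (hgen : ∃ N₀, ∀ n ≥ N₀, P (n + 1) ≤ I • P n ⊔ Q (n + 1))
    (hQL : ∀ n, Q n ≤ L n) (hLP : ∀ n, L n ≤ P n) (hL : ∀ n, I • L n ≤ L (n + 1)) :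
    ∃ N₀, ∀ n ≥ N₀, L (n + 1) ≤ I • L n ⊔ Q (n + 1) := by
  obtain ⟨N₀, hgen⟩ := hgen
  have hP : ∀ n, P (N₀ + n) ≤ I ^ n • P N₀ ⊔ Q (N₀ + n) := fun n ↦ by
    induction n with
    | zero => simp
    | succ n ih =>
      refine (hgen (N₀ + n) (by omega)).trans (sup_le ?_ le_sup_right)
      refine (Submodule.smul_mono le_rfl ih).trans ?_
      rw [Submodule.smul_sup, pow_succ', Submodule.mul_smul]
      exact sup_le_sup_left (hQ _) _
  obtain ⟨N₁, h⟩ := I.exists_forall_eq_smul_of_le_pow_smul (P N₀)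
    (fun n ↦ I ^ n • P N₀ ⊓ L (N₀ + n)) (fun _ ↦ inf_le_left) (fun n ↦ by
      refine le_inf ?_ ((Submodule.smul_mono le_rfl inf_le_right).trans (hL _))
      rw [pow_succ', Submodule.mul_smul]
      exact Submodule.smul_mono le_rfl inf_le_left)
  refine ⟨N₀ + N₁, fun n hn ↦ ?_⟩
  obtain ⟨k, rfl⟩ : ∃ k, n = N₀ + k := ⟨n - N₀, by omega⟩
  calc L (N₀ + k + 1)
      ≤ (Q (N₀ + (k + 1)) ⊔ I ^ (k + 1) • P N₀) ⊓ L (N₀ + (k + 1)) :=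
        le_inf ((hLP _).trans ((hP (k + 1)).trans (sup_comm _ _).le)) le_rfl
    _ = Q (N₀ + (k + 1)) ⊔ I ^ (k + 1) • P N₀ ⊓ L (N₀ + (k + 1)) :=
        sup_inf_assoc_of_le _ (hQL _)
    _ ≤ _ := by
        rw [h k (by omega), sup_comm]
        exact sup_le_sup_right (Submodule.smul_mono le_rfl inf_le_right) _

end ArtinRees

section RelativeLength

variable {R : Type*} {B : Type u} [CommRing R] [AddCommGroup B] [Module R B]

/-- The quotient `P / (P ∩ Q)` of two submodules of a common module. -/
abbrev Subquotient (P Q : Submodule R B) : Type u := ↥P ⧸ Q.submoduleOf P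

theorem Subquotient.length_add {P Q T : Submodule R B} (hTQ : T ≤ Q) (hQP : Q ≤ P) :
    Module.length R (Subquotient P T) =
      Module.length R (Subquotient Q T) + Module.length R (Subquotient P Q) := by
  refine Module.length_eq_add_of_exact
    (Submodule.mapQ _ _ (Submodule.inclusion hQP) fun x hx ↦ hx)
    (Submodule.factor (Submodule.comap_mono hTQ)) ?_
    (Submodule.factor_surjective _) ?_
  · rw [injective_iff_map_eq_zero]
    intro b hb
    obtain ⟨b, rfl⟩ := Submodule.mkQ_surjective _ b
    have hb : Submodule.Quotient.mk (p := T.submoduleOf P) (Submodule.inclusion hQP b) = 0 := hb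
    exact (Submodule.Quotient.mk_eq_zero _).2
      ((Submodule.Quotient.mk_eq_zero (T.submoduleOf P)).1 hb)
  · intro b
    obtain ⟨b, rfl⟩ := Submodule.mkQ_surjective _ b
    refine (Submodule.Quotient.mk_eq_zero (Q.submoduleOf P)).trans
      ⟨fun hb ↦ ⟨Submodule.mkQ _ ⟨b, hb⟩, rfl⟩, ?_⟩
    rintro ⟨c, hc⟩
    obtain ⟨c, rfl⟩ := Submodule.mkQ_surjective _ c
    have h := (Submodule.Quotient.eq (T.submoduleOf P)).1 hc
    have : (b : B) = c - ((c : B) - b) := by simp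
    change (b : B) ∈ Q
    rw [this]
    exact Q.sub_mem c.2 (hTQ h)

theorem Subquotient.length_sup_eq (P Q : Submodule R B) :
    Module.length R (Subquotient (P ⊔ Q) Q) = Module.length R (Subquotient P (P ⊓ Q)) := by
  refine (((Submodule.quotEquivOfEq _ _ ?_).trans
    (LinearMap.quotientInfEquivSupQuotient P Q)).length_eq).symm
  simp [Submodule.submoduleOf]

theorem eventuallyPolynomial_length_subquotient [IsNoetherianRing R] [Module.Finite R B]
    (I : Ideal R) (P Q : ℕ → Submodule R B) (hQP : ∀ n, Q n ≤ P n)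
    (hP : ∀ n, I • P n ≤ P (n + 1)) (hQ : ∀ n, I • Q n ≤ Q (n + 1))
    (hgen : ∃ N₀, ∀ n ≥ N₀, P (n + 1) ≤ I • P n ⊔ Q (n + 1))
    (hfin : ∃ N₀, ∀ n ≥ N₀, IsFiniteLength R (Subquotient (P n) (Q n))) :
    EventuallyPolynomial (fun n ↦ (Module.length R (Subquotient (P n) (Q n))).toNat) := by
  obtain ⟨r, y, hy⟩ := Submodule.fg_iff_exists_fin_generating_family.1 (IsNoetherian.noetherian I)
  have hyI : ∀ j, y j ∈ I := fun j ↦ hy ▸ Submodule.subset_span ⟨j, rfl⟩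
  have hsmul : ∀ (N T : Submodule R B), (∀ j, ∀ b ∈ N, y j • b ∈ T) → I • N ≤ T := by
    intro N T h
    rw [Submodule.smul_le]
    intro a ha b hb
    rw [← hy] at ha
    induction ha using Submodule.span_induction with
    | mem a ha => obtain ⟨j, rfl⟩ := ha; exact h j b hb
    | zero => simp
    | add a c _ _ ha hc => rw [add_smul]; exact add_mem ha hc
    | smul a c _ hc => rw [smul_assoc]; exact T.smul_mem a hc
  have hyP : ∀ j n, ∀ b ∈ P n, y j • b ∈ P (n + 1) := fun j n b hb ↦
    hP n (Submodule.smul_mem_smul (hyI j) hb)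
  have hyQ : ∀ j n, ∀ b ∈ Q n, y j • b ∈ Q (n + 1) := fun j n b hb ↦
    hQ n (Submodule.smul_mem_smul (hyI j) hb)
  let z : ∀ (_ : Fin r) n, P n →ₗ[R] P (n + 1) := fun j n ↦
    (LinearMap.lsmul R B (y j)).restrict (hyP j n)
  let x : ∀ (_ : Fin r) n, Subquotient (P n) (Q n) →ₗ[R] Subquotient (P (n + 1)) (Q (n + 1)) :=
    fun j n ↦ Submodule.mapQ _ _ (z j n) fun b hb ↦ hyQ j n b hb
  refine eventuallyPolynomial_length_of_operators r (fun n ↦ Subquotient (P n) (Q n)) x ?_ hfin ?_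
  · intro i j n m
    obtain ⟨m, rfl⟩ := Submodule.mkQ_surjective _ m
    refine congr_arg (Submodule.mkQ _) (Subtype.ext ?_)
    exact smul_comm (y i) (y j) (m : B)
  · intro L hL
    let L' : ℕ → Submodule R B := fun n ↦
      ((L n).comap ((Q n).submoduleOf (P n)).mkQ).map (P n).subtype
    obtain ⟨N₀, h⟩ := I.exists_forall_le_smul_sup P Q L' hQ hgen
      (fun n b hb ↦ ⟨⟨b, hQP n hb⟩, by
        have : ((Q n).submoduleOf (P n)).mkQ ⟨b, hQP n hb⟩ = 0 :=
          (Submodule.Quotient.mk_eq_zero _).2 hb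
        rw [SetLike.mem_coe, Submodule.mem_comap, this]
        exact zero_mem _, rfl⟩)
      (fun n ↦ Submodule.map_subtype_le _ _)
      (fun n ↦ hsmul _ _ (by
        rintro j _ ⟨b, hb, rfl⟩
        exact ⟨z j n b, hL j n ⟨_, hb, rfl⟩, rfl⟩))
    refine ⟨N₀, fun n hn m hm ↦ ?_⟩
    have hT : L' (n + 1) ≤ ((⨆ j, (L n).map (x j n)).comap
        ((Q (n + 1)).submoduleOf (P (n + 1))).mkQ).map (P (n + 1)).subtype := by
      refine (h n hn).trans (sup_le (hsmul _ _ ?_) ?_)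
      · rintro j _ ⟨b, hb, rfl⟩
        exact ⟨z j n b, Submodule.mem_iSup_of_mem j ⟨_, hb, rfl⟩, rfl⟩
      · intro b hb
        refine ⟨⟨b, hQP _ hb⟩, ?_, rfl⟩
        have : ((Q (n + 1)).submoduleOf (P (n + 1))).mkQ ⟨b, hQP _ hb⟩ = 0 :=
          (Submodule.Quotient.mk_eq_zero _).2 hb
        rw [SetLike.mem_coe, Submodule.mem_comap, this]
        exact zero_mem _
    obtain ⟨b, rfl⟩ := Submodule.mkQ_surjective _ m
    obtain ⟨c, hc, hcb⟩ := hT ⟨b, hm, rfl⟩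
    rwa [← Subtype.ext hcb]

/-- The homology of `A / Iⁿ A → B / Iⁿ B → C / Iⁿ C`, written as a subquotient of `B`, has
eventually polynomial length as soon as its length is finite. -/
theorem eventuallyPolynomial_length_homology [IsNoetherianRing R] [Module.Finite R B]
    {A C : Type*} [AddCommGroup A] [Module R A] [AddCommGroup C] [Module R C] [Module.Finite R C]
    (I : Ideal R) (f : A →ₗ[R] B) (g : B →ₗ[R] C) (hfg : g ∘ₗ f = 0)
    (hfin : ∀ n ≥ 1, IsFiniteLength R (Subquotient ((I ^ n • ⊤ : Submodule R C).comap g)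
      (LinearMap.range f ⊔ I ^ n • ⊤))) :
    EventuallyPolynomial (fun n ↦ (Module.length R (Subquotient
      ((I ^ n • ⊤ : Submodule R C).comap g) (LinearMap.range f ⊔ I ^ n • ⊤))).toNat) := by
  set Z := LinearMap.ker g
  set U : ℕ → Submodule R B := fun n ↦ (I ^ n • ⊤ : Submodule R C).comap g
  set V : ℕ → Submodule R B := fun n ↦ LinearMap.range f ⊔ I ^ n • ⊤
  let W : ℕ → Submodule R B := fun n ↦ Z ⊔ I ^ n • ⊤
  have hfZ : LinearMap.range f ≤ Z := LinearMap.range_le_ker_iff.2 hfg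
  have hVW : ∀ n, V n ≤ W n := fun n ↦ sup_le_sup_right hfZ _
  have hWU : ∀ n, W n ≤ U n := fun n ↦ by
    refine sup_le (LinearMap.ker_le_comap g) ?_
    rw [← Submodule.map_le_iff_le_comap, Submodule.map_smul'']
    exact Submodule.smul_mono le_rfl le_top
  have hWZ : ∀ n, W n = Z ⊔ V n := fun n ↦ by
    rw [← sup_assoc, sup_eq_left.2 hfZ]
  have hadd : ∀ n, Module.length R (Subquotient (U n) (V n)) =
      Module.length R (Subquotient Z (Z ⊓ V n)) + Module.length R (Subquotient (U n) (W n)) :=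
    fun n ↦ by rw [Subquotient.length_add (hVW n) (hWU n), hWZ, Subquotient.length_sup_eq]
  have hVanti : ∀ n, V (n + 1) ≤ V n := fun n ↦
    sup_le_sup_left (Submodule.smul_mono (Ideal.pow_le_pow_right n.le_succ) le_rfl) _
  have hIV : ∀ n, I • V n ≤ V (n + 1) := fun n ↦ by
    change _ ≤ LinearMap.range f ⊔ I ^ (n + 1) • ⊤
    rw [Submodule.smul_sup, pow_succ', Submodule.mul_smul]
    exact sup_le_sup_right Submodule.smul_le_right _
  have hZV : ∀ n, Module.length R (Subquotient Z (Z ⊓ V (n + 1))) =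
      Module.length R (Subquotient (Z ⊓ V n) (Z ⊓ V (n + 1))) +
        Module.length R (Subquotient Z (Z ⊓ V n)) := fun n ↦
    Subquotient.length_add (inf_le_inf_left _ (hVanti n)) inf_le_left
  have hne : ∀ n ≥ 1, Module.length R (Subquotient Z (Z ⊓ V n)) ≠ ⊤ ∧
      Module.length R (Subquotient (U n) (W n)) ≠ ⊤ := fun n hn ↦ by
    have := (hfin n hn).length_ne_top
    rw [hadd n] at this
    exact ⟨fun h ↦ this (by simp [h]), fun h ↦ this (by simp [h])⟩
  have hne' : ∀ n ≥ 1, Module.length R (Subquotient (Z ⊓ V n) (Z ⊓ V (n + 1))) ≠ ⊤ :=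
    fun n hn h ↦ (hne (n + 1) (by omega)).1 (by simp [hZV n, h])
  have hUW : EventuallyPolynomial (fun n ↦ (Module.length R (Subquotient (U n) (W n))).toNat) := by
    refine eventuallyPolynomial_length_subquotient I U W hWU (fun n ↦ ?_) (fun n ↦ ?_) ?_
      ⟨1, fun n hn ↦ Module.length_ne_top_iff.1 (hne n hn).2⟩
    · rw [← Submodule.map_le_iff_le_comap, Submodule.map_smul'', pow_succ', Submodule.mul_smul]
      exact Submodule.smul_mono le_rfl (Submodule.map_comap_le _ _)
    · change _ ≤ Z ⊔ I ^ (n + 1) • ⊤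
      rw [Submodule.smul_sup, pow_succ', Submodule.mul_smul]
      exact sup_le_sup_right Submodule.smul_le_right _
    · obtain ⟨N₀, h⟩ := I.exists_forall_eq_smul_of_le_pow_smul (⊤ : Submodule R C)
        (fun n ↦ (U n).map g) (fun n ↦ Submodule.map_comap_le _ _) (fun n ↦ by
          rw [← Submodule.map_smul'']
          refine Submodule.map_mono ?_
          rw [← Submodule.map_le_iff_le_comap, Submodule.map_smul'', pow_succ', Submodule.mul_smul]
          exact Submodule.smul_mono le_rfl (Submodule.map_comap_le _ _))
      refine ⟨N₀, fun n hn ↦ ?_⟩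
      have h := h n hn
      rw [← Submodule.map_smul''] at h
      have h' : U (n + 1) ≤ I • U n ⊔ Z := by
        rw [← Submodule.comap_map_eq, ← Submodule.map_le_iff_le_comap]
        exact h.le
      exact h'.trans (sup_le_sup_left le_sup_left _)
  have hZ : EventuallyPolynomial
      (fun n ↦ (Module.length R (Subquotient (Z ⊓ V n) (Z ⊓ V (n + 1)))).toNat) := by
    have hIZV : ∀ n, I • (Z ⊓ V n) ≤ Z ⊓ V (n + 1) := fun n ↦
      le_inf (Submodule.smul_le_right.trans inf_le_left)
        ((Submodule.smul_mono le_rfl inf_le_right).trans (hIV n))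
    have hgen : ∃ N₀, ∀ n ≥ N₀, Z ⊓ V (n + 1) ≤ I • (Z ⊓ V n) ⊔ Z ⊓ V (n + 1 + 1) := by
      obtain ⟨N₀, h⟩ := I.exists_forall_eq_smul_of_le_pow_smul (⊤ : Submodule R B)
        (fun n ↦ I ^ n • ⊤ ⊓ Z) (fun n ↦ inf_le_left) (fun n ↦ by
          refine le_inf ?_ (Submodule.smul_le_right.trans inf_le_right)
          rw [pow_succ', Submodule.mul_smul]
          exact Submodule.smul_mono le_rfl inf_le_left)
      refine ⟨N₀, fun n hn ↦ ?_⟩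
      calc Z ⊓ V (n + 1) = V (n + 1) ⊓ Z := inf_comm _ _
        _ = LinearMap.range f ⊔ I ^ (n + 1) • ⊤ ⊓ Z := sup_inf_assoc_of_le _ hfZ
        _ = LinearMap.range f ⊔ I • (I ^ n • ⊤ ⊓ Z) := by rw [h n hn]
        _ ≤ _ := sup_le ((le_inf hfZ le_sup_left).trans le_sup_right)
          ((Submodule.smul_mono le_rfl
            (le_inf inf_le_right (inf_le_left.trans le_sup_right))).trans le_sup_left)
    exact eventuallyPolynomial_length_subquotient I (fun n ↦ Z ⊓ V n) (fun n ↦ Z ⊓ V (n + 1))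
      (fun n ↦ inf_le_inf_left _ (hVanti n)) hIZV (fun n ↦ hIZV (n + 1)) hgen
      ⟨1, fun n hn ↦ Module.length_ne_top_iff.1 (hne' n hn)⟩
  have hZ' : EventuallyPolynomial
      (fun n ↦ (Module.length R (Subquotient Z (Z ⊓ V n))).toNat) := by
    refine hZ.of_add_eq_add (c := fun _ ↦ 0) ⟨0, 0, by simp⟩ ⟨1, fun n hn ↦ ?_⟩
    rw [hZV n, ENat.toNat_add (hne' n hn) (hne n hn).1, add_zero, add_comm]
  refine (hZ'.add hUW).congr ⟨1, fun n hn ↦ ?_⟩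
  rw [hadd n, ENat.toNat_add (hne n hn).1 (hne n hn).2]

end RelativeLength

section FiniteLength

theorem isFiniteLength_of_maximalIdeal_le_radical_annihilator {R X : Type*} [CommRing R]
    [IsNoetherianRing R] [IsLocalRing R] [AddCommGroup X] [Module R X] [Module.Finite R X]
    (h : IsLocalRing.maximalIdeal R ≤ (Module.annihilator R X).radical) : IsFiniteLength R X := by
  rcases subsingleton_or_nontrivial X with _ | _
  · exact .of_subsingleton
  refine isFiniteLength_iff_isNoetherian_isArtinian.2 ⟨inferInstance, ?_⟩
  let A := R ⧸ Module.annihilator R X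
  have hne : Module.annihilator R X ≠ ⊤ := fun h ↦
    not_subsingleton X (Module.annihilator_eq_top_iff.1 h)
  have : Nontrivial A := Ideal.Quotient.nontrivial_iff.2 hne
  have : IsLocalRing A := .of_surjective' _ Ideal.Quotient.mk_surjective
  obtain ⟨k, hk⟩ := Ideal.exists_pow_le_of_le_radical_of_fg h (IsNoetherian.noetherian _)
  have : IsArtinianRing A := by
    refine (isArtinianRing_iff_isNilpotent_maximalIdeal A).2 ⟨k, ?_⟩
    rw [← IsLocalRing.map_maximalIdeal_of_surjective _
      (Ideal.Quotient.mk_surjective (I := Module.annihilator R X)), ← Ideal.map_pow,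
      Ideal.zero_eq_bot, Ideal.map_eq_bot_iff_le_ker, Ideal.mk_ker]
    exact hk
  let : Module A X := Module.quotientAnnihilator
  have : IsScalarTower R A X := ⟨fun r a x ↦ by
    obtain ⟨a, rfl⟩ := Ideal.Quotient.mk_surjective a
    exact mul_smul r a x⟩
  let e : X →ₛₗ[Ideal.Quotient.mk (Module.annihilator R X)] X := ⟨.id _, fun _ _ ↦ rfl⟩
  have : Module.Finite A X := .of_restrictScalars_finite R A X
  rw [e.isArtinian_iff_of_bijective Function.bijective_id]
  infer_instance

end FiniteLength

namespace CategoryTheory.ShortComplex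

variable {R : Type u} [CommRing R] (S : ShortComplex (ModuleCat.{u} R))

/-- The homology of a short complex of modules, in terms of modules which surject onto those of the
complex. -/
theorem nonempty_homology_linearEquiv_subquotient {A B C : Type u} [AddCommGroup A] [Module R A]
    [AddCommGroup B] [Module R B] [AddCommGroup C] [Module R C] (f : A →ₗ[R] B) (g : B →ₗ[R] C)
    (a : A →ₗ[R] S.X₁) (b : B →ₗ[R] S.X₂) (c : C →ₗ[R] S.X₃)
    (ha : Function.Surjective a) (hb : Function.Surjective b)
    (hab : S.f.hom ∘ₗ a = b ∘ₗ f) (hbc : S.g.hom ∘ₗ b = c ∘ₗ g) :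
    Nonempty (Subquotient ((LinearMap.ker c).comap g) (LinearMap.range f ⊔ LinearMap.ker b) ≃ₗ[R]
      S.homology) := by
  have hab x : S.f.hom (a x) = b (f x) := congr($hab x)
  have hbc x : S.g.hom (b x) = c (g x) := congr($hbc x)
  let φ : (LinearMap.ker c).comap g →ₗ[R]
      LinearMap.ker S.g.hom ⧸ LinearMap.range S.moduleCatToCycles :=
    Submodule.mkQ _ ∘ₗ b.restrict fun x hx ↦ (hbc x).trans hx
  have hφ : Function.Surjective φ := by
    refine (Submodule.mkQ_surjective _).comp fun ⟨y, hy⟩ ↦ ?_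
    obtain ⟨x, rfl⟩ := hb y
    exact ⟨⟨x, (hbc x).symm.trans hy⟩, rfl⟩
  have hker : LinearMap.ker φ = (LinearMap.range f ⊔ LinearMap.ker b).submoduleOf _ := by
    ext ⟨x, hx⟩
    refine (Submodule.Quotient.mk_eq_zero (LinearMap.range S.moduleCatToCycles)).trans
      (Iff.trans ?_ (Submodule.mem_sup (x := x)).symm)
    constructor
    · rintro ⟨y, hy⟩
      obtain ⟨z, rfl⟩ := ha y
      have hz : S.f.hom (a z) = b x := congr_arg Subtype.val hy
      exact ⟨f z, ⟨z, rfl⟩, x - f z, by simp [← hz, hab], by simp⟩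
    · rintro ⟨_, ⟨z, rfl⟩, y, hy, rfl⟩
      refine ⟨a z, Subtype.ext ((hab z).trans ?_)⟩
      change _ = b (f z + y)
      rw [map_add, LinearMap.mem_ker.1 hy, add_zero]
  exact ⟨(Submodule.quotEquivOfEq _ _ hker.symm).trans
    ((φ.quotKerEquivOfSurjective hφ).trans S.moduleCatHomologyIso.toLinearEquiv.symm)⟩

theorem finite_homology [IsNoetherianRing R] [Module.Finite R S.X₂] :
    Module.Finite R S.homology :=
  have : Module.Finite R (LinearMap.ker S.g.hom ⧸ LinearMap.range S.moduleCatToCycles) :=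
    inferInstance
  have e : (LinearMap.ker S.g.hom ⧸ LinearMap.range S.moduleCatToCycles) ≃ₗ[R] S.homology :=
    S.moduleCatHomologyIso.toLinearEquiv.symm
  .equiv e

theorem mem_annihilator_homology (r : R) (s : S.X₂ →ₗ[R] S.X₁) (t : S.X₃ →ₗ[R] S.X₂)
    (h : ∀ x, r • x = S.f.hom (s x) + t (S.g.hom x)) :
    r ∈ Module.annihilator R S.homology := by
  have e : (LinearMap.ker S.g.hom ⧸ LinearMap.range S.moduleCatToCycles) ≃ₗ[R] S.homology :=
    S.moduleCatHomologyIso.toLinearEquiv.symm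
  rw [← e.annihilator_eq, Module.mem_annihilator]
  intro x
  obtain ⟨⟨x, hx⟩, rfl⟩ := Submodule.mkQ_surjective _ x
  rw [← map_smul]
  refine (Submodule.Quotient.mk_eq_zero _).2 ⟨s x, Subtype.ext ?_⟩
  change S.f.hom (s x) = r • x
  rw [h, LinearMap.mem_ker.1 hx, map_zero, add_zero]

end CategoryTheory.ShortComplex

section Assembly

variable {R : Type u} [CommRing R]

theorem isFiniteLength_and_eventuallyPolynomial_homology [IsNoetherianRing R] [IsLocalRing R]
    (I : Ideal R) {A B C : Type u} [AddCommGroup A] [Module R A] [AddCommGroup B] [Module R B]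
    [AddCommGroup C] [Module R C] [Module.Finite R B] [Module.Finite R C] (f : A →ₗ[R] B)
    (g : B →ₗ[R] C) (hfg : g ∘ₗ f = 0) (S : ℕ → ShortComplex (ModuleCat.{u} R))
    (a : ∀ n, A →ₗ[R] (S n).X₁) (b : ∀ n, B →ₗ[R] (S n).X₂) (c : ∀ n, C →ₗ[R] (S n).X₃)
    (ha : ∀ n, Function.Surjective (a n)) (hb : ∀ n, Function.Surjective (b n))
    (hab : ∀ n, (S n).f.hom ∘ₗ a n = b n ∘ₗ f) (hbc : ∀ n, (S n).g.hom ∘ₗ b n = c n ∘ₗ g)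
    (hkb : ∀ n, LinearMap.ker (b n) = I ^ n • ⊤) (hkc : ∀ n, LinearMap.ker (c n) = I ^ n • ⊤)
    (hann : ∀ n ≥ 1,
      IsLocalRing.maximalIdeal R ≤ (Module.annihilator R (S n).homology).radical) :
    (∀ n ≥ 1, IsFiniteLength R (S n).homology) ∧
      EventuallyPolynomial (fun n ↦ (Module.length R (S n).homology).toNat) := by
  have e n : Nonempty (Subquotient ((I ^ n • ⊤ : Submodule R C).comap g)
      (LinearMap.range f ⊔ I ^ n • ⊤) ≃ₗ[R] (S n).homology) := by
    rw [← hkb n, ← hkc n]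
    exact (S n).nonempty_homology_linearEquiv_subquotient f g (a n) (b n) (c n) (ha n) (hb n)
      (hab n) (hbc n)
  have hfin : ∀ n ≥ 1, IsFiniteLength R (S n).homology := fun n hn ↦ by
    have : Module.Finite R (S n).X₂ := .of_surjective (b n) (hb n)
    have := (S n).finite_homology
    exact isFiniteLength_of_maximalIdeal_le_radical_annihilator (hann n hn)
  refine ⟨hfin, (eventuallyPolynomial_length_homology I f g hfg fun n hn ↦
    (e n).some.symm.isFiniteLength (hfin n hn)).congr ⟨0, fun n _ ↦ ?_⟩⟩
  rw [(e n).some.length_eq]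

theorem Submodule.smul_top_le_ker {B X : Type*} [AddCommGroup B] [Module R B] [AddCommGroup X]
    [Module R X] (J : Ideal R) (b : B →ₗ[R] X) (h : J ≤ Module.annihilator R X) :
    J • ⊤ ≤ LinearMap.ker b := by
  rw [Submodule.smul_le]
  intro r hr x _
  rw [LinearMap.mem_ker, map_smul, Module.mem_annihilator.1 (h hr)]

theorem Ideal.le_annihilator_quotient_smul_top {N : Type*} [AddCommGroup N] [Module R N]
    (J : Ideal R) : J ≤ Module.annihilator R (N ⧸ (J • ⊤ : Submodule R N)) := by
  intro r hr
  rw [Module.mem_annihilator]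
  intro x
  obtain ⟨x, rfl⟩ := Submodule.mkQ_surjective _ x
  rw [← map_smul]
  exact (Submodule.Quotient.mk_eq_zero _).2 (Submodule.smul_mem_smul hr trivial)

theorem Module.annihilator_le_annihilator_tensorProduct {N P : Type*} [AddCommGroup N] [Module R N]
    [AddCommGroup P] [Module R P] :
    Module.annihilator R N ≤ Module.annihilator R (TensorProduct R N P) := by
  refine fun r hr ↦ Module.mem_annihilator.2 fun x ↦ ?_
  induction x with
  | zero => simp
  | tmul x y => rw [TensorProduct.smul_tmul', Module.mem_annihilator.1 hr, TensorProduct.zero_tmul]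
  | add x y hx hy => rw [smul_add, hx, hy, add_zero]

theorem Module.annihilator_le_annihilator_linearMap {N P : Type*} [AddCommGroup N] [Module R N]
    [AddCommGroup P] [Module R P] :
    Module.annihilator R N ≤ Module.annihilator R (P →ₗ[R] N) :=
  fun _ hr ↦ Module.mem_annihilator.2 fun _ ↦ LinearMap.ext fun _ ↦ Module.mem_annihilator.1 hr _

theorem ker_rTensor_mkQ_smul_top {N P : Type*} [AddCommGroup N] [Module R N] [AddCommGroup P]
    [Module R P] (J : Ideal R) :
    LinearMap.ker ((J • ⊤ : Submodule R N).mkQ.rTensor P) = J • ⊤ := by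
  apply le_antisymm
  · rw [(rTensor_exact P (LinearMap.exact_subtype_mkQ _)
      (Submodule.mkQ_surjective _)).linearMap_ker_eq, LinearMap.range_le_iff_comap, eq_top_iff,
      ← TensorProduct.span_tmul_eq_top, Submodule.span_le]
    rintro _ ⟨⟨x, hx⟩, p, rfl⟩
    have : (J • ⊤ : Submodule R N).map ((TensorProduct.mk R N P).flip p) ≤ J • ⊤ := by
      rw [Submodule.map_smul'']
      exact Submodule.smul_mono le_rfl le_top
    exact this ⟨x, hx, rfl⟩
  · exact Submodule.smul_top_le_ker J _ (J.le_annihilator_quotient_smul_top.trans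
      Module.annihilator_le_annihilator_tensorProduct)

theorem ker_compRight_mkQ_smul_top {N P : Type*} [AddCommGroup N] [Module R N] [AddCommGroup P]
    [Module R P] [Module.Finite R P] [Module.Projective R P] (J : Ideal R) :
    LinearMap.ker (LinearMap.compRight R (M := P) (J • ⊤ : Submodule R N).mkQ) = J • ⊤ := by
  apply le_antisymm
  · intro φ hφ
    obtain ⟨n, π, s, -, -, hs⟩ := Module.Finite.exists_comp_eq_id_of_projective R P
    have hmem x : φ x ∈ (J • ⊤ : Submodule R N) :=
      (Submodule.Quotient.mk_eq_zero _).1 congr($hφ x)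
    have hsum : φ = ∑ i, ((LinearMap.proj i : (Fin n → R) →ₗ[R] R) ∘ₗ s).smulRight
        (φ (π (Pi.single i 1))) := by
      ext x
      have hx : π (s x) = x := congr($hs x)
      conv_lhs => rw [← hx, pi_eq_sum_univ' (s x), map_sum, map_sum]
      simp [LinearMap.sum_apply]
    rw [hsum]
    refine Submodule.sum_mem _ fun i _ ↦ ?_
    let l : N →ₗ[R] P →ₗ[R] N := LinearMap.smulRightₗ ((LinearMap.proj i) ∘ₗ s)
    have : (J • ⊤ : Submodule R N).map l ≤ J • ⊤ := by
      rw [Submodule.map_smul'']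
      exact Submodule.smul_mono le_rfl le_top
    exact this ⟨_, hmem _, rfl⟩
  · exact Submodule.smul_top_le_ker J _ (J.le_annihilator_quotient_smul_top.trans
      Module.annihilator_le_annihilator_linearMap)

theorem CategoryTheory.ProjectiveResolution.exists_smul_eq {M : Type u} [AddCommGroup M]
    [Module R M] (P : ProjectiveResolution (ModuleCat.of R M)) {r : R}
    (hr : r ∈ Module.annihilator R M) (i : ℕ) :
    ∃ (s : P.complex.X i ⟶ P.complex.X (i + 1)) (t : P.complex.X (i - 1) ⟶ P.complex.X i),
      r • 𝟙 (P.complex.X i) = P.complex.d i (i - 1) ≫ t + s ≫ P.complex.d (i + 1) i := by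
  have h : (r • 𝟙 P.complex) ≫ P.π = 0 := by
    ext x
    rw [← (HomologicalComplex.singleObjXSelf (ComplexShape.down ℕ) 0
      (ModuleCat.of R M)).toLinearEquiv.annihilator_eq] at hr
    have := Module.mem_annihilator.1 hr (P.π.f 0 x)
    rw [Linear.smul_comp, Category.id_comp]
    exact this
  have H := ProjectiveResolution.liftHomotopyZero (r • 𝟙 P.complex) h
  have := H.comm i
  rw [dNext_nat, prevD_eq H.hom (show (ComplexShape.down ℕ).Rel (i + 1) i from rfl)] at this
  exact ⟨_, _, by simpa using this⟩

end Assembly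

section TorExt

theorem maximalIdeal_le_radical_of_support {R : Type*} [CommRing R] [IsLocalRing R] {I : Ideal R}
    {M N : Type*} [AddCommGroup M] [Module R M] [Module.Finite R M] [AddCommGroup N] [Module R N]
    [Module.Finite R N]
    (hsupp : Module.support R N ∩ Module.support R M ∩ PrimeSpectrum.zeroLocus (I : Set R) =
      {⟨IsLocalRing.maximalIdeal R, (IsLocalRing.maximalIdeal.isMaximal R).isPrime⟩})
    {n : ℕ} (hn : 1 ≤ n) : IsLocalRing.maximalIdeal R ≤
      (Module.annihilator R M ⊔
        Module.annihilator R (N ⧸ (I ^ n • ⊤ : Submodule R N))).radical := by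
  have h : IsLocalRing.maximalIdeal R ≤
      (Module.annihilator R N ⊔ Module.annihilator R M ⊔ I ^ n).radical := by
    rw [Module.support_eq_zeroLocus, Module.support_eq_zeroLocus, ← PrimeSpectrum.zeroLocus_sup,
      ← PrimeSpectrum.zeroLocus_pow I (Nat.one_le_iff_ne_zero.1 hn),
      ← PrimeSpectrum.zeroLocus_sup] at hsupp
    rw [← PrimeSpectrum.vanishingIdeal_zeroLocus_eq_radical, hsupp,
      PrimeSpectrum.vanishingIdeal_singleton]
  refine h.trans (Ideal.radical_mono (sup_le (sup_le ?_ le_sup_left) ?_))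
  · exact (LinearMap.annihilator_le_of_surjective _ (Submodule.mkQ_surjective _)).trans le_sup_right
  · exact (I ^ n).le_annihilator_quotient_smul_top.trans le_sup_right

variable {R : Type u} [CommRing R] [IsNoetherianRing R] [IsLocalRing R] (I : Ideal R)
  (M N : Type u) [AddCommGroup M] [Module R M] [Module.Finite R M] [AddCommGroup N] [Module R N]
  [Module.Finite R N]

open MonoidalCategory in
theorem isFiniteLength_and_eventuallyPolynomial_tor
    (h : ∀ n ≥ 1, IsLocalRing.maximalIdeal R ≤
      (Module.annihilator R M ⊔
        Module.annihilator R (N ⧸ (I ^ n • ⊤ : Submodule R N))).radical) (i : ℕ) :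
    (∀ n ≥ 1, IsFiniteLength R (((Tor (ModuleCat.{u} R) i).obj
      (ModuleCat.of R (N ⧸ (I ^ n • ⊤ : Submodule R N)))).obj (ModuleCat.of R M))) ∧
    EventuallyPolynomial (fun n ↦ (Module.length R (((Tor (ModuleCat.{u} R) i).obj
      (ModuleCat.of R (N ⧸ (I ^ n • ⊤ : Submodule R N)))).obj (ModuleCat.of R M))).toNat) := by
  obtain ⟨P, hP⟩ := exists_finite_projectiveResolution (R := R) M
  let K (n : ℕ) := (((tensoringLeft (ModuleCat.{u} R)).obj
    (ModuleCat.of R (N ⧸ (I ^ n • ⊤ : Submodule R N)))).mapHomologicalComplex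
      (ComplexShape.down ℕ)).obj P.complex
  let S (n : ℕ) : ShortComplex (ModuleCat.{u} R) := (K n).sc' (i + 1) i (i - 1)
  have e n : ((Tor (ModuleCat.{u} R) i).obj (ModuleCat.of R (N ⧸ (I ^ n • ⊤ : Submodule R N)))).obj
      (ModuleCat.of R M) ≃ₗ[R] (S n).homology :=
    (P.isoLeftDerivedObj _ i ≪≫ (K n).homologyIsoSc' (i + 1) i (i - 1) (by simp)
      (by cases i <;> simp)).toLinearEquiv
  have key := isFiniteLength_and_eventuallyPolynomial_homology I
    ((P.complex.d (i + 1) i).hom.lTensor N) ((P.complex.d i (i - 1)).hom.lTensor N)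
    (by
      rw [← LinearMap.lTensor_comp, ← ModuleCat.hom_comp, P.complex.d_comp_d]
      simp) S
    (fun n ↦ (I ^ n • ⊤ : Submodule R N).mkQ.rTensor (P.complex.X (i + 1)))
    (fun n ↦ (I ^ n • ⊤ : Submodule R N).mkQ.rTensor (P.complex.X i))
    (fun n ↦ (I ^ n • ⊤ : Submodule R N).mkQ.rTensor (P.complex.X (i - 1)))
    (fun n ↦ LinearMap.rTensor_surjective _ (Submodule.mkQ_surjective _))
    (fun n ↦ LinearMap.rTensor_surjective _ (Submodule.mkQ_surjective _))
    (fun n ↦ (LinearMap.lTensor_comp_rTensor _ _ _).trans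
      (LinearMap.rTensor_comp_lTensor _ _ _).symm)
    (fun n ↦ (LinearMap.lTensor_comp_rTensor _ _ _).trans
      (LinearMap.rTensor_comp_lTensor _ _ _).symm)
    (fun n ↦ ker_rTensor_mkQ_smul_top _) (fun n ↦ ker_rTensor_mkQ_smul_top _)
    (fun n hn ↦ (h n hn).trans (Ideal.radical_mono (sup_le ?_ ?_)))
  · exact ⟨fun n hn ↦ (e n).symm.isFiniteLength (key.1 n hn),
      key.2.congr ⟨0, fun n _ ↦ by rw [(e n).length_eq]⟩⟩
  · intro r hr
    obtain ⟨s, t, hst⟩ := P.exists_smul_eq hr i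
    refine (S n).mem_annihilator_homology r (s.hom.lTensor _) (t.hom.lTensor _) fun x ↦ ?_
    have := congr(($hst).hom.lTensor (N ⧸ (I ^ n • ⊤ : Submodule R N)) x)
    simp only [ModuleCat.hom_add, ModuleCat.hom_comp, ModuleCat.hom_smul, ModuleCat.hom_id,
      LinearMap.lTensor_add, LinearMap.lTensor_comp, LinearMap.lTensor_smul,
      LinearMap.lTensor_id] at this
    exact this.trans (add_comm _ _)
  · intro r hr
    refine (S n).mem_annihilator_homology r 0 0 fun x ↦ ?_
    have : r • x = 0 :=
      Module.mem_annihilator.1 (Module.annihilator_le_annihilator_tensorProduct hr) x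
    simpa using this

theorem isFiniteLength_and_eventuallyPolynomial_ext
    (h : ∀ n ≥ 1, IsLocalRing.maximalIdeal R ≤
      (Module.annihilator R M ⊔
        Module.annihilator R (N ⧸ (I ^ n • ⊤ : Submodule R N))).radical) (i : ℕ) :
    (∀ n ≥ 1, IsFiniteLength R (((Ext R (ModuleCat.{u} R) i).obj
      (Opposite.op (ModuleCat.of R M))).obj (ModuleCat.of R (N ⧸ (I ^ n • ⊤ : Submodule R N))))) ∧
    EventuallyPolynomial (fun n ↦ (Module.length R (((Ext R (ModuleCat.{u} R) i).obj
      (Opposite.op (ModuleCat.of R M))).obj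
        (ModuleCat.of R (N ⧸ (I ^ n • ⊤ : Submodule R N))))).toNat) := by
  obtain ⟨P, hP⟩ := exists_finite_projectiveResolution (R := R) M
  have hproj j : Module.Projective R (P.complex.X j) :=
    (IsProjective.iff_projective _).2 (P.projective j)
  let K (n : ℕ) := P.complex.linearYonedaObj R (ModuleCat.of R (N ⧸ (I ^ n • ⊤ : Submodule R N)))
  let S (n : ℕ) : ShortComplex (ModuleCat.{u} R) := (K n).sc' (i - 1) i (i + 1)
  have e n : ((Ext R (ModuleCat.{u} R) i).obj (Opposite.op (ModuleCat.of R M))).obj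
      (ModuleCat.of R (N ⧸ (I ^ n • ⊤ : Submodule R N))) ≃ₗ[R] (S n).homology :=
    (P.isoExt i _ ≪≫ (K n).homologyIsoSc' (i - 1) i (i + 1) (by cases i <;> simp)
      (by simp)).toLinearEquiv
  let q (n j : ℕ) : (P.complex.X j →ₗ[R] N) →ₗ[R] (K n).X j :=
    (ModuleCat.homLinearEquiv (S := R)).symm.toLinearMap ∘ₗ
      LinearMap.compRight R (M := P.complex.X j) (I ^ n • ⊤ : Submodule R N).mkQ
  have hq n j : Function.Surjective (q n j) :=
    (ModuleCat.homLinearEquiv (S := R)).symm.surjective.comp fun φ ↦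
      Module.projective_lifting_property _ φ (Submodule.mkQ_surjective _)
  have hkq n j : LinearMap.ker (q n j) = I ^ n • ⊤ :=
    (LinearEquiv.ker_comp _ _).trans (ker_compRight_mkQ_smul_top _)
  have key := isFiniteLength_and_eventuallyPolynomial_homology I
    (LinearMap.lcomp R N (P.complex.d i (i - 1)).hom)
    (LinearMap.lcomp R N (P.complex.d (i + 1) i).hom)
    (by
      ext φ x
      have : (P.complex.d i (i - 1)).hom ((P.complex.d (i + 1) i).hom x) = 0 :=
        congr(($(P.complex.d_comp_d (i + 1) i (i - 1))).hom x)
      simp [this]) S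
    (fun n ↦ q n (i - 1)) (fun n ↦ q n i) (fun n ↦ q n (i + 1))
    (fun n ↦ hq n _) (fun n ↦ hq n _)
    (fun n ↦ rfl) (fun n ↦ rfl) (fun n ↦ hkq n _) (fun n ↦ hkq n _)
    (fun n hn ↦ (h n hn).trans (Ideal.radical_mono (sup_le ?_ ?_)))
  · exact ⟨fun n hn ↦ (e n).symm.isFiniteLength (key.1 n hn),
      key.2.congr ⟨0, fun n _ ↦ by rw [(e n).length_eq]⟩⟩
  · intro r hr
    obtain ⟨s, t, hst⟩ := P.exists_smul_eq hr i
    have hφ (φ : P.complex.X i ⟶ ModuleCat.of R (N ⧸ (I ^ n • ⊤ : Submodule R N))) :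
        r • φ = P.complex.d i (i - 1) ≫ t ≫ φ + s ≫ P.complex.d (i + 1) i ≫ φ := by
      rw [← Category.assoc, ← Category.assoc, ← Preadditive.add_comp, ← hst, Linear.smul_comp,
        Category.id_comp]
    exact (S n).mem_annihilator_homology r (Linear.leftComp R _ t) (Linear.leftComp R _ s) hφ
  · intro r hr
    refine (S n).mem_annihilator_homology r 0 0 fun φ ↦ ?_
    have : r • φ = 0 := ModuleCat.hom_ext
      (Module.mem_annihilator.1 (Module.annihilator_le_annihilator_linearMap hr) φ.hom)
    simpa using this

end TorExt

/-- Corollary 4, last part. Let `(R, m)` be a commutative Noetherian local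
ring, `I` an ideal, and `M`, `N` finitely generated `R`-modules with
`Supp(N) ∩ Supp(M) ∩ V(I) = {m}`.  Then for every `i ≥ 0`, both `Tor_i(N/IⁿN, M)` and
`Ext^i(M, N/IⁿN)` have finite length for all `n ≥ 1`, and there are polynomials
`pᵢ, qᵢ ∈ ℚ[X]` with `λ(Tor_i(N/IⁿN, M)) = pᵢ(n)` and `λ(Ext^i(M, N/IⁿN)) = qᵢ(n)` for all
`n ≫ 0`. -/
theorem stmt_10 {R : Type u} [CommRing R] [IsNoetherianRing R] [IsLocalRing R] (I : Ideal R)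
    (M N : Type u) [AddCommGroup M] [Module R M] [Module.Finite R M]
    [AddCommGroup N] [Module R N] [Module.Finite R N]
    (hsupp : Module.support R N ∩ Module.support R M ∩
        PrimeSpectrum.zeroLocus (I : Set R) =
      {⟨IsLocalRing.maximalIdeal R, (IsLocalRing.maximalIdeal.isMaximal R).isPrime⟩}) :
    ∀ i : ℕ,
      (∀ n : ℕ, 1 ≤ n →
        IsFiniteLength R (torModule R i (N ⧸ (I ^ n • ⊤ : Submodule R N)) M) ∧
        IsFiniteLength R (extModule R i M (N ⧸ (I ^ n • ⊤ : Submodule R N)))) ∧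
      (∃ (p : Polynomial ℚ) (N₀ : ℕ), ∀ n ≥ N₀, ∃ ℓ : ℕ,
        moduleLength R (torModule R i (N ⧸ (I ^ n • ⊤ : Submodule R N)) M) = ℓ ∧
        (ℓ : ℚ) = p.eval (n : ℚ)) ∧
      (∃ (q : Polynomial ℚ) (N₀ : ℕ), ∀ n ≥ N₀, ∃ ℓ : ℕ,
        moduleLength R (extModule R i M (N ⧸ (I ^ n • ⊤ : Submodule R N))) = ℓ ∧
        (ℓ : ℚ) = q.eval (n : ℚ)) := by
  intro i
  have hm : ∀ n ≥ 1, _ := fun n hn ↦ maximalIdeal_le_radical_of_support hsupp hn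
  obtain ⟨hT, p, Np, hp⟩ := isFiniteLength_and_eventuallyPolynomial_tor I M N hm i
  obtain ⟨hE, q, Nq, hq⟩ := isFiniteLength_and_eventuallyPolynomial_ext I M N hm i
  have hlen {X : Type u} [AddCommGroup X] [Module R X] (hX : IsFiniteLength R X) :
      moduleLength R X = ((Module.length R X).toNat : ℕ) := by
    rw [moduleLength, ← Module.coe_length, ← ENat.natCast_toNat hX.length_ne_top]
    rfl
  exact ⟨fun n hn ↦ ⟨hT n hn, hE n hn⟩,
    ⟨p, max Np 1, fun n hn ↦ ⟨_, hlen (hT n (le_of_max_le_right hn)), hp n (le_of_max_le_left hn)⟩⟩,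
    ⟨q, max Nq 1, fun n hn ↦ ⟨_, hlen (hE n (le_of_max_le_right hn)), hq n (le_of_max_le_left hn)⟩⟩⟩
end

section
/- Let R be a commutative Noetherian ring, I an ideal, N a finitely generated R-module, and M an R-module (not necessarily finitely generated) such that V(I) ∩ Supp(M) ∩ Supp(N) is a finite set S of maximal ideals of R. Fix i ≥ 0 and assume that for every m ∈ S and every j ∈ {i−1, i} with j ≥ 0, the Bass number μ^j(m, M) is finite. If Ext_R^i(N/I^n N, M) has finite length for all sufficiently large n, then there exists a polynomial p with rational coefficients such that λ(Ext_R^i(N/I^n N, M)) = p(n) for all sufficiently large n. -/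
set_option synthInstance.maxHeartbeats 1000000

open CategoryTheory

universe u

section Combinatorics

theorem exists_forall_ge_eq_of_antitone_of_wellQuasiOrdered {P Q : Type*} [Preorder P]
    [WellQuasiOrderedLE P] [PartialOrder Q] [WellFoundedLT Q] (L : ℕ → P → Q)
    (hL : Antitone L) (hL' : ∀ t, Antitone (L t)) : ∃ t₀, ∀ t ≥ t₀, L t = L t₀ := by
  by_contra! hcon
  have hstep : ∀ t₀, ∃ t, t₀ ≤ t ∧ ∃ v, L t v < L t₀ v := by
    intro t₀
    obtain ⟨t, ht, hne⟩ := hcon t₀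
    have hlt : L t < L t₀ := lt_of_le_of_ne (hL ht) hne
    obtain ⟨-, v, hv⟩ := Pi.lt_def.mp hlt
    exact ⟨t, ht, v, hv⟩
  choose T hT v hv using hstep
  let τ : ℕ → ℕ := fun k => T^[k] 0
  have hτ : ∀ k, τ (k + 1) = T (τ k) := fun k => Function.iterate_succ_apply' T k 0
  have hτm : Monotone τ := monotone_nat_of_le_succ fun k => by rw [hτ]; exact hT _
  obtain ⟨g, hg⟩ := (wellQuasiOrdered_le (α := P)).exists_monotone_subseq fun k => v (τ k)
  refine (RelEmbedding.natGT (r := ((· < ·) : Q → Q → Prop))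
    (fun j => L (τ (g j)) (v (τ (g j)))) ?_).not_wellFounded wellFounded_lt
  intro j
  refine lt_of_le_of_lt ?_ (hv (τ (g j)))
  refine (hL' _ (hg j (j + 1) (Nat.le_succ j))).trans (hL ?_ _)
  rw [← hτ]
  exact hτm (g.strictMono (Nat.lt_succ_self j))

/-- A sequence of extended natural numbers which is eventually finite and given by a polynomial. -/
def IsEventuallyPolynomial (h : ℕ → ℕ∞) : Prop :=
  ∃ (p : Polynomial ℚ) (N₀ : ℕ), ∀ n ≥ N₀, ∃ l : ℕ, h n = l ∧ (l : ℚ) = p.eval (n : ℚ)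

theorem Polynomial.exists_eval_add_one_sub_eval (q : Polynomial ℚ) :
    ∃ p : Polynomial ℚ, ∀ x : ℚ, p.eval (x + 1) - p.eval x = q.eval x := by
  induction q using Polynomial.induction_on' with
  | add q r hq hr =>
    obtain ⟨p, hp⟩ := hq
    obtain ⟨p', hp'⟩ := hr
    refine ⟨p + p', fun x => ?_⟩
    rw [eval_add, eval_add, eval_add, ← hp, ← hp']
    ring
  | monomial k a =>
    refine ⟨C (a / (k + 1)) * Polynomial.bernoulli (k + 1), fun x => ?_⟩
    have h := Polynomial.bernoulli_eval_one_add (k + 1) x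
    have hk : (k + 1 : ℚ) ≠ 0 := by positivity
    rw [add_comm x 1]
    simp only [eval_mul, eval_C, eval_monomial, h]
    push_cast
    field_simp
    ring

theorem IsEventuallyPolynomial.of_succ_add {h a c : ℕ → ℕ∞} (hfin : ∃ N₀, ∀ n ≥ N₀, h n ≠ ⊤)
    (ha : IsEventuallyPolynomial a) (hc : IsEventuallyPolynomial c)
    (heq : ∀ n, h (n + 1) + c n = h n + a n) : IsEventuallyPolynomial h := by
  obtain ⟨N₀, hN₀⟩ := hfin
  obtain ⟨p, N₁, hp⟩ := ha
  obtain ⟨q, N₂, hq⟩ := hc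
  obtain ⟨r, hr⟩ := Polynomial.exists_eval_add_one_sub_eval (p - q)
  let N := max N₀ (max N₁ N₂)
  have hl : ∀ n ≥ N, ((h n).toNat : ℕ∞) = h n := fun n hn =>
    ENat.natCast_toNat (hN₀ n (le_trans (le_max_left _ _) hn))
  refine ⟨r + Polynomial.C ((h N).toNat - r.eval (N : ℚ)), N, fun n hn =>
    ⟨(h n).toNat, (hl n hn).symm, ?_⟩⟩
  induction n, hn using Nat.le_induction with
  | base => simp
  | succ n hn ih =>
    obtain ⟨k, hk, hk'⟩ := hp n (le_trans (le_trans (le_max_left _ _) (le_max_right _ _)) hn)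
    obtain ⟨m, hm, hm'⟩ := hq n (le_trans (le_trans (le_max_right _ _) (le_max_right _ _)) hn)
    have h1 := heq n
    rw [hk, hm, ← hl n hn, ← hl (n + 1) (Nat.le_succ_of_le hn)] at h1
    have h2 : ((h (n + 1)).toNat : ℚ) + m = (h n).toNat + k := by exact_mod_cast h1
    have h3 := hr n
    simp only [Polynomial.eval_add, Polynomial.eval_sub, Polynomial.eval_C] at ih h3 ⊢
    push_cast
    linarith

theorem IsEventuallyPolynomial.congr {h h' : ℕ → ℕ∞} (hh : IsEventuallyPolynomial h)
    (H : ∃ N₀, ∀ n ≥ N₀, h' n = h n) : IsEventuallyPolynomial h' := by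
  obtain ⟨p, N₁, hp⟩ := hh
  obtain ⟨N₀, hN₀⟩ := H
  refine ⟨p, max N₀ N₁, fun n hn => ?_⟩
  rw [hN₀ n (le_trans (le_max_left _ _) hn)]
  exact hp n (le_trans (le_max_right _ _) hn)

theorem IsEventuallyPolynomial.add {h h' : ℕ → ℕ∞} (hh : IsEventuallyPolynomial h)
    (hh' : IsEventuallyPolynomial h') : IsEventuallyPolynomial (fun n => h n + h' n) := by
  obtain ⟨p, N₁, hp⟩ := hh
  obtain ⟨q, N₂, hq⟩ := hh'
  refine ⟨p + q, max N₁ N₂, fun n hn => ?_⟩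
  obtain ⟨k, hk, hk'⟩ := hp n (le_trans (le_max_left _ _) hn)
  obtain ⟨m, hm, hm'⟩ := hq n (le_trans (le_max_right _ _) hn)
  exact ⟨k + m, by simp [hk, hm], by simp [hk', hm']⟩

end Combinatorics

section RelativeLength

variable {R : Type*} [CommRing R] {D D' : Type*} [AddCommGroup D'] [Module R D']
  [AddCommGroup D] [Module R D]

/-- The length of `B / (A ⊓ B)`. -/
noncomputable def relativeLength (A B : Submodule R D) : ℕ∞ :=
  Module.length R (B ⧸ A.submoduleOf B)

theorem relativeLength_eq_length_range {P : Type*} [AddCommGroup P] [Module R P]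
    {A B : Submodule R D} (g : B →ₗ[R] P) (hg : ∀ b, g b = 0 ↔ (b : D) ∈ A) :
    relativeLength A B = Module.length R (LinearMap.range g) := by
  have hk : LinearMap.ker g = A.submoduleOf B := by
    ext b
    simp [hg, Submodule.submoduleOf]
  rw [relativeLength, ← hk]
  exact (g.quotKerEquivRange).length_eq

theorem relativeLength_self (A : Submodule R D) : relativeLength A A = 0 := by
  rw [relativeLength_eq_length_range (0 : A →ₗ[R] D) (fun b => by simp),
    LinearMap.range_zero, Module.length_bot]

theorem relativeLength_add {A B C : Submodule R D} (hAB : A ≤ B) (hBC : B ≤ C) :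
    relativeLength A C = relativeLength A B + relativeLength B C := by
  let g := A.mkQ ∘ₗ C.subtype
  have h1 : relativeLength A C = Module.length R (LinearMap.range g) :=
    relativeLength_eq_length_range g (fun b => by simp [g])
  have h2 : relativeLength A B = Module.length R (LinearMap.range (A.mkQ ∘ₗ B.subtype)) :=
    relativeLength_eq_length_range _ (fun b => by simp)
  let k : (LinearMap.range g) →ₗ[R] D ⧸ B := Submodule.factor hAB ∘ₗ (LinearMap.range g).subtype
  have h3 : relativeLength B C = Module.length R (LinearMap.range k) := by
    rw [relativeLength_eq_length_range (k ∘ₗ g.rangeRestrict) (fun b => by simp [k, g]),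
      LinearMap.range_comp_of_range_eq_top _ (LinearMap.range_rangeRestrict g)]
  have hle : LinearMap.range (A.mkQ ∘ₗ B.subtype) ≤ LinearMap.range g := by
    rintro _ ⟨b, rfl⟩
    exact ⟨⟨b, hBC b.2⟩, rfl⟩
  rw [h1, h2, h3]
  refine Module.length_eq_add_of_exact (Submodule.inclusion hle) k.rangeRestrict
    (Submodule.inclusion_injective hle) (LinearMap.surjective_rangeRestrict k) ?_
  rintro ⟨_, ⟨c, rfl⟩⟩
  simp only [Subtype.ext_iff, LinearMap.codRestrict_apply, LinearMap.rangeRestrict,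
    ZeroMemClass.coe_zero, Set.mem_range]
  constructor
  · intro h
    have hc : (c : D) ∈ B := by simpa [k, g] using h
    exact ⟨⟨_, ⟨⟨c, hc⟩, rfl⟩⟩, rfl⟩
  · rintro ⟨⟨_, ⟨b, rfl⟩⟩, h⟩
    have h' : (Submodule.Quotient.mk (b : D) : D ⧸ A) = Submodule.Quotient.mk (c : D) := h
    rw [Submodule.Quotient.eq] at h'
    have hc : (c : D) ∈ B := by
      have := B.sub_mem b.2 (hAB h')
      simpa using this
    simpa [k, g] using hc

theorem relativeLength_map (f : D →ₗ[R] D') (B : Submodule R D) (A' : Submodule R D') :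
    relativeLength (B ⊓ A'.comap f) B = relativeLength A' (A' ⊔ B.map f) := by
  rw [relativeLength_eq_length_range (A'.mkQ ∘ₗ f ∘ₗ B.subtype) (fun b => by simp),
    relativeLength_eq_length_range (A'.mkQ ∘ₗ (A' ⊔ B.map f).subtype) (fun b => by simp)]
  have : LinearMap.range (A'.mkQ ∘ₗ f ∘ₗ B.subtype) =
      LinearMap.range (A'.mkQ ∘ₗ (A' ⊔ B.map f).subtype) := by
    rw [LinearMap.range_comp, LinearMap.range_comp, LinearMap.range_comp, Submodule.range_subtype,
      Submodule.range_subtype, Submodule.map_sup]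
    simp
  rw [this]

theorem relativeLength_le_left {A B C : Submodule R D} (hAB : A ≤ B) (hBC : B ≤ C) :
    relativeLength A B ≤ relativeLength A C := by
  rw [relativeLength_add hAB hBC]
  exact le_self_add

theorem relativeLength_le_right {A B C : Submodule R D} (hAB : A ≤ B) (hBC : B ≤ C) :
    relativeLength B C ≤ relativeLength A C := by
  rw [relativeLength_add hAB hBC]
  exact le_add_self

end RelativeLength

section Hilbert

variable {R : Type*} [CommRing R] {D : Type*} [AddCommGroup D] [Module R D]

/-- A family of submodules indexed by degrees such that every element of `s` lowers degrees
by one. -/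
def IsLowering (s : Finset R) (G : ℕ → Submodule R D) : Prop :=
  ∀ x ∈ s, ∀ n, ∀ g ∈ G (n + 1), x • g ∈ G n

/-- The descending chain condition on lowering families between `A` and `B`. -/
def LoweringDCC (s : Finset R) (A B : ℕ → Submodule R D) : Prop :=
  ∀ G : ℕ → ℕ → Submodule R D, (∀ t, IsLowering s (G t)) → (∀ t, A ≤ G t) → (∀ t, G t ≤ B) →
    Antitone G → ∃ t₀, ∀ t ≥ t₀, G t = G t₀

theorem isEventuallyPolynomial_relativeLength (s : Finset R) (A B : ℕ → Submodule R D)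
    (hA : IsLowering s A) (hB : IsLowering s B) (hAB : A ≤ B) (hdcc : LoweringDCC s A B)
    (hfin : ∃ N₀, ∀ n ≥ N₀, relativeLength (A n) (B n) ≠ ⊤) :
    IsEventuallyPolynomial (fun n => relativeLength (A n) (B n)) := by
  classical
  induction s using Finset.induction_on generalizing A B with
  | empty =>
    obtain ⟨t₀, ht₀⟩ := hdcc (fun t n => if n < t then A n else B n)
      (fun t x hx => by simp at hx)
      (fun t n => by dsimp only; split_ifs; exacts [le_rfl, hAB n])
      (fun t n => by dsimp only; split_ifs; exacts [hAB n, le_rfl])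
      (fun t t' htt' n => by
        dsimp only
        split_ifs with h1 h2
        exacts [le_rfl, hAB n, absurd (lt_of_lt_of_le ‹_› htt') h1, le_rfl])
    refine ⟨0, t₀, fun n hn => ⟨0, ?_, by simp⟩⟩
    have h := congrFun (ht₀ (n + 1) (by omega)) n
    simp only [Nat.lt_succ_self, if_true, not_lt.mpr hn, if_false] at h
    dsimp only
    rw [h, relativeLength_self]
    rfl
  | insert x s hx ih =>
    have hAs : IsLowering s A := fun y hy => hA y (Finset.mem_insert_of_mem hy)
    have hBs : IsLowering s B := fun y hy => hB y (Finset.mem_insert_of_mem hy)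
    have hxA := hA x (Finset.mem_insert_self _ _)
    have hxB := hB x (Finset.mem_insert_self _ _)
    let m : D →ₗ[R] D := LinearMap.lsmul R D x
    let K : ℕ → Submodule R D := fun n => Nat.casesOn n (B 0) fun n => B (n + 1) ⊓ (A n).comap m
    let C : ℕ → Submodule R D := fun n => A n ⊔ (B (n + 1)).map m
    have hAK : A ≤ K := by
      rintro (_ | n)
      · exact hAB 0
      · exact le_inf (hAB _) fun g hg => hxA n g hg
    have hKB : K ≤ B := by
      rintro (_ | n)
      · exact le_rfl
      · exact inf_le_left
    have hAC : A ≤ C := fun n => le_sup_left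
    have hCB : C ≤ B := by
      refine fun n => sup_le (hAB n) ?_
      rintro _ ⟨g, hg, rfl⟩
      exact hxB n g hg
    have hKs : IsLowering s K := by
      rintro y hy (_ | n) g hg
      · exact hBs y hy 0 g hg.1
      · refine ⟨hBs y hy _ g hg.1, ?_⟩
        have := hAs y hy n _ hg.2
        simpa [m, smul_comm x y] using this
    have hCs : IsLowering s C := by
      intro y hy n g hg
      obtain ⟨a, ha, _, ⟨b, hb, rfl⟩, rfl⟩ := Submodule.mem_sup.mp hg
      rw [smul_add]
      refine Submodule.add_mem_sup (hAs y hy n a ha) ⟨y • b, hBs y hy _ b hb, ?_⟩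
      simp [m]
    have dcc1 : LoweringDCC s A K := by
      intro G hG hGA hGK hanti
      refine hdcc G ?_ hGA (fun t => (hGK t).trans hKB) hanti
      intro t y hy n g hg
      rcases Finset.mem_insert.mp hy with rfl | hy
      · exact hGA t n (hGK t (n + 1) hg).2
      · exact hG t y hy n g hg
    have dcc2 : LoweringDCC s C B := by
      intro G hG hGC hGB hanti
      refine hdcc G ?_ (fun t => hAC.trans (hGC t)) hGB hanti
      intro t y hy n g hg
      rcases Finset.mem_insert.mp hy with rfl | hy
      · exact hGC t n (Submodule.mem_sup_right ⟨g, hGB t _ hg, rfl⟩)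
      · exact hG t y hy n g hg
    obtain ⟨N₀, hN₀⟩ := hfin
    have p1 := ih A K hAs hKs hAK dcc1 ⟨N₀, fun n hn => ne_top_of_le_ne_top (hN₀ n hn)
      (relativeLength_le_left (hAK n) (hKB n))⟩
    have p2 := ih C B hCs hBs hCB dcc2 ⟨N₀, fun n hn => ne_top_of_le_ne_top (hN₀ n hn)
      (relativeLength_le_right (hAC n) (hCB n))⟩
    have p1' : IsEventuallyPolynomial fun n => relativeLength (A (n + 1)) (K (n + 1)) := by
      obtain ⟨p, N, hp⟩ := p1
      refine ⟨p.comp (Polynomial.X + 1), N, fun n hn => ?_⟩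
      obtain ⟨l, hl, hl'⟩ := hp (n + 1) (by omega)
      exact ⟨l, hl, by simpa using hl'⟩
    refine IsEventuallyPolynomial.of_succ_add ⟨N₀, hN₀⟩ p1' p2 fun n => ?_
    rw [relativeLength_add (hAK (n + 1)) (hKB (n + 1)), relativeLength_add (hAC n) (hCB n)]
    have : relativeLength (K (n + 1)) (B (n + 1)) = relativeLength (A n) (C n) :=
      relativeLength_map m (B (n + 1)) (A n)
    rw [this]
    ring

end Hilbert

section Leading

variable {R : Type*} [CommRing R] {D : Type*} [AddCommGroup D] [Module R D] {d : ℕ}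

/-- The value at `x` of the monomial with exponent `v`. -/
def monomialValue (x : Fin d → R) (v : Fin d →₀ ℕ) : R := v.prod fun i k => x i ^ k

theorem monomialValue_add (x : Fin d → R) (v w : Fin d →₀ ℕ) :
    monomialValue x (v + w) = monomialValue x v * monomialValue x w :=
  Finsupp.prod_add_index' (fun _ => pow_zero _) (fun _ _ _ => pow_add _ _ _)

theorem monomialValue_single (x : Fin d → R) (i : Fin d) (k : ℕ) :
    monomialValue x (Finsupp.single i k) = x i ^ k :=
  Finsupp.prod_single_index (pow_zero _)

theorem IsLowering.monomialValue_smul_mem [DecidableEq R] {x : Fin d → R}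
    {G : ℕ → Submodule R D} (hG : IsLowering (Finset.univ.image x) G) (v : Fin d →₀ ℕ) :
    ∀ n, ∀ g ∈ G (n + v.degree), monomialValue x v • g ∈ G n := by
  induction v using Finsupp.induction_linear with
  | zero => intro n g hg; simpa [monomialValue] using hg
  | add v w hv hw =>
    intro n g hg
    rw [monomialValue_add, mul_smul]
    refine hv _ _ (hw _ _ ?_)
    rwa [map_add, ← add_assoc] at hg
  | single i k =>
    rw [Finsupp.degree_single, monomialValue_single]
    induction k with
    | zero => intro n g hg; simpa using hg
    | succ k ih =>
      intro n g hg
      rw [pow_succ, mul_smul]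
      exact ih n _ (hG (x i) (Finset.mem_image_of_mem _ (Finset.mem_univ i)) _ g hg)

/-- The submodule of leading coefficients at the exponent `v` of a family of submodules. -/
def leadingSubmodule (x : Fin d → R) (G : ℕ → Submodule R D) (v : Fin d →₀ ℕ) : Submodule R D where
  carrier := {a | ∃ g ∈ G v.degree, (∀ w : Fin d →₀ ℕ, w.degree = v.degree →
    MonomialOrder.lex.toSyn v < MonomialOrder.lex.toSyn w → monomialValue x w • g = 0) ∧
    monomialValue x v • g = a}
  zero_mem' := ⟨0, Submodule.zero_mem _, fun _ _ _ => smul_zero _, smul_zero _⟩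
  add_mem' := by
    rintro _ _ ⟨g, hg, hg', rfl⟩ ⟨h, hh, hh', rfl⟩
    exact ⟨g + h, Submodule.add_mem _ hg hh, fun w hw hvw => by
      rw [smul_add, hg' w hw hvw, hh' w hw hvw, add_zero], smul_add _ _ _⟩
  smul_mem' := by
    rintro r _ ⟨g, hg, hg', rfl⟩
    exact ⟨r • g, Submodule.smul_mem _ r hg, fun w hw hvw => by
      rw [smul_comm, hg' w hw hvw, smul_zero], smul_comm _ _ _⟩

theorem leadingSubmodule_mono (x : Fin d → R) {G G' : ℕ → Submodule R D} (h : G ≤ G')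
    (v : Fin d →₀ ℕ) : leadingSubmodule x G v ≤ leadingSubmodule x G' v := by
  rintro a ⟨g, hg, H⟩
  exact ⟨g, h _ hg, H⟩

theorem IsLowering.leadingSubmodule_le [DecidableEq R] {x : Fin d → R}
    {G : ℕ → Submodule R D} (hG : IsLowering (Finset.univ.image x) G) (v : Fin d →₀ ℕ) :
    leadingSubmodule x G v ≤ G 0 := by
  rintro a ⟨g, hg, -, rfl⟩
  exact hG.monomialValue_smul_mem v 0 g (by rwa [zero_add])

theorem IsLowering.antitone_leadingSubmodule [DecidableEq R] {x : Fin d → R}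
    {G : ℕ → Submodule R D} (hG : IsLowering (Finset.univ.image x) G) :
    Antitone (leadingSubmodule x G) := by
  intro v v' hvv' a
  obtain ⟨u, rfl⟩ := exists_add_of_le hvv'
  rintro ⟨g, hg, hg', rfl⟩
  rw [map_add] at hg
  refine ⟨monomialValue x u • g, hG.monomialValue_smul_mem u _ g hg, fun w hw hvw => ?_, ?_⟩
  · rw [smul_smul, ← monomialValue_add]
    refine hg' _ (by rw [map_add, map_add, hw]) ?_
    rw [map_add, map_add]
    exact add_lt_add_left hvw _
  · rw [smul_smul, ← monomialValue_add]

theorem eq_of_leadingSubmodule_eq {x : Fin d → R} {G G' : ℕ → Submodule R D} (h : G ≤ G')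
    (hL : leadingSubmodule x G = leadingSubmodule x G')
    (hK : ∀ n g, (∀ v : Fin d →₀ ℕ, v.degree = n → monomialValue x v • g = 0) → g ∈ G n) :
    G = G' := by
  refine le_antisymm h fun n => ?_
  have key : ∀ s : WithTop (MonomialOrder.lex (σ := Fin d)).syn, ∀ g ∈ G' n,
      (∀ w : Fin d →₀ ℕ, w.degree = n → s ≤ (MonomialOrder.lex.toSyn w : WithTop _) →
        monomialValue x w • g = 0) → g ∈ G n := by
    intro s
    induction s using WellFoundedLT.induction with
    | ind s ih =>
      intro g hg hs
      by_cases hall : ∀ w : Fin d →₀ ℕ, w.degree = n → monomialValue x w • g = 0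
      · exact hK n g hall
      push Not at hall
      have hfin : {w : Fin d →₀ ℕ | w.degree = n ∧ monomialValue x w • g ≠ 0}.Finite := by
        refine (Finsupp.finite_of_degree_le (n := n)).subset fun w hw => ?_
        exact hw.1.le
      obtain ⟨v, ⟨hvn, hv⟩, hmax⟩ := Set.exists_max_image _
        (MonomialOrder.lex (σ := Fin d)).toSyn hfin hall
      have hvs : (MonomialOrder.lex.toSyn v : WithTop _) < s := by
        by_contra hle
        exact hv (hs v hvn (not_lt.mp hle))
      have hzero : ∀ w : Fin d →₀ ℕ, w.degree = v.degree →
          MonomialOrder.lex.toSyn v < MonomialOrder.lex.toSyn w →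
          monomialValue x w • g = 0 := by
        intro w hw hvw
        by_contra hne
        exact absurd (hmax w ⟨hw.trans hvn, hne⟩) (not_le.mpr hvw)
      have hmem : monomialValue x v • g ∈ leadingSubmodule x G v := by
        rw [hL]
        exact ⟨g, by rwa [hvn], hzero, rfl⟩
      obtain ⟨g₁, hg₁, hg₁', heq⟩ := hmem
      rw [hvn] at hg₁
      have hsub : g - g₁ ∈ G n := by
        refine ih _ hvs _ (Submodule.sub_mem _ hg (h n hg₁)) fun w hw hvw => ?_
        rw [smul_sub]
        rcases (WithTop.coe_le_coe.mp hvw).eq_or_lt with hvw | hvw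
        · rw [← MonomialOrder.lex.toSyn.injective hvw, heq, sub_self]
        · rw [hzero w (hw.trans hvn.symm) hvw, hg₁' w (hw.trans hvn.symm) hvw, sub_zero]
      simpa using Submodule.add_mem _ hsub hg₁
  exact fun g hg => key ⊤ g hg fun w _ hw => absurd (top_le_iff.mp hw) (WithTop.coe_ne_top)

end Leading

section Artinian

variable {R : Type*} [CommRing R] {D : Type*} [AddCommGroup D] [Module R D]

theorem mem_torsionBySet_pow_succ {I : Ideal R} {n : ℕ} {g : D} :
    g ∈ Submodule.torsionBySet R D (I ^ (n + 1) : Ideal R) ↔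
      ∀ a ∈ I, a • g ∈ Submodule.torsionBySet R D (I ^ n : Ideal R) := by
  simp only [Submodule.mem_torsionBySet_iff, Subtype.forall, SetLike.mem_coe]
  constructor
  · intro h a ha b hb
    rw [smul_smul]
    exact h _ (pow_succ I n ▸ Ideal.mul_mem_mul hb ha)
  · intro h c hc
    rw [pow_succ] at hc
    induction hc using Submodule.mul_induction_on' with
    | mem_mul_mem b hb a ha => rw [mul_smul]; exact h a ha b hb
    | add y _ z _ hy hz => rw [add_smul, hy, hz, add_zero]

theorem torsionBySet_pow_zero (I : Ideal R) :
    Submodule.torsionBySet R D (I ^ 0 : Ideal R) = ⊥ := by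
  rw [eq_bot_iff]
  intro g hg
  rw [Submodule.mem_torsionBySet_iff] at hg
  simpa using hg ⟨1, by simp⟩

theorem torsionBySet_pow_mono (I : Ideal R) :
    Monotone fun n => Submodule.torsionBySet R D (I ^ n : Ideal R) := fun _ _ h =>
  Submodule.torsionBySet_le_torsionBySet_of_subset (Ideal.pow_le_pow_right h)

theorem mem_torsionBySet_span_pow {d : ℕ} (x : Fin d → R) (n : ℕ) (g : D)
    (h : ∀ v : Fin d →₀ ℕ, v.degree = n → monomialValue x v • g = 0) :
    g ∈ Submodule.torsionBySet R D (Ideal.span (Set.range x) ^ n : Ideal R) := by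
  induction n generalizing g with
  | zero =>
    have := h 0 (by simp)
    simp only [monomialValue, Finsupp.prod_zero_index, one_smul] at this
    rw [this]
    exact Submodule.zero_mem _
  | succ n ih =>
    rw [mem_torsionBySet_pow_succ]
    intro a ha
    induction ha using Submodule.span_induction with
    | mem a ha =>
      obtain ⟨i, rfl⟩ := ha
      refine ih _ fun v hv => ?_
      have := h (v + Finsupp.single i 1) (by simp [hv])
      rwa [monomialValue_add, monomialValue_single, pow_one, mul_smul] at this
    | zero => rw [zero_smul]; exact Submodule.zero_mem _
    | add a b _ _ ha hb => rw [add_smul]; exact Submodule.add_mem _ ha hb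
    | smul r a _ ha => rw [smul_assoc]; exact Submodule.smul_mem _ r ha

theorem exists_forall_ge_eq_of_isArtinian [DecidableEq R] {d : ℕ} (x : Fin d → R)
    (A : Submodule R D) [IsArtinian R A] (G : ℕ → ℕ → Submodule R D)
    (hG : ∀ t, IsLowering (Finset.univ.image x) (G t)) (hanti : Antitone G)
    (h0 : ∀ t, G t 0 ≤ A)
    (hK : ∀ t n, Submodule.torsionBySet R D (Ideal.span (Set.range x) ^ n : Ideal R) ≤ G t n) :
    ∃ t₀, ∀ t ≥ t₀, G t = G t₀ := by
  obtain ⟨t₀, ht₀⟩ := exists_forall_ge_eq_of_antitone_of_wellQuasiOrdered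
    (P := Fin d →₀ ℕ) (Q := Submodule R A)
    (fun t v => (leadingSubmodule x (G t) v).submoduleOf A)
    (fun t t' h v => Submodule.comap_mono (leadingSubmodule_mono x (hanti h) v))
    (fun t v v' h => Submodule.comap_mono ((hG t).antitone_leadingSubmodule h))
  refine ⟨t₀, fun t ht => eq_of_leadingSubmodule_eq (x := x) (hanti ht) ?_ fun n g hg =>
    hK t n (mem_torsionBySet_span_pow x n g hg)⟩
  funext v
  have hle : ∀ t, leadingSubmodule x (G t) v ≤ A := fun t =>
    ((hG t).leadingSubmodule_le v).trans (h0 t)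
  have := congrArg (Submodule.map A.subtype) (congrFun (ht₀ t ht) v)
  simpa [Submodule.submoduleOf, Submodule.map_comap_subtype, inf_eq_right.mpr (hle _)] using this

/-- Melkersson's criterion: if every element of `D` is killed by a power of a finitely generated
ideal `I` and the annihilator of `I` in `D` is Artinian, then `D` is Artinian. -/
theorem isArtinian_of_torsion {I : Ideal R} (hI : I.FG)
    (htors : ∀ g : D, ∃ n, g ∈ Submodule.torsionBySet R D (I ^ n : Ideal R))
    (hart : IsArtinian R (Submodule.torsionBySet R D I)) : IsArtinian R D := by
  classical
  obtain ⟨d, x, rfl⟩ := Submodule.fg_iff_exists_fin_generating_family.mp hI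
  set I := Submodule.span R (Set.range x) with hIdef
  have hxI : ∀ y ∈ Finset.univ.image x, y ∈ I := by
    intro y hy
    obtain ⟨i, -, rfl⟩ := Finset.mem_image.mp hy
    exact Submodule.subset_span ⟨i, rfl⟩
  let T : ℕ → Submodule R D := fun n => Submodule.torsionBySet R D (I ^ n : Ideal R)
  have hT : Monotone T := torsionBySet_pow_mono I
  refine (monotone_stabilizes_iff_artinian (R := R) (M := D)).mp fun W => ?_
  let V : ℕ → Submodule R D := fun n => OrderDual.ofDual (W n)
  have hV : Antitone V := fun a b hab => W.monotone hab
  have hstab : ∃ t₀, ∀ t ≥ t₀, (fun n => (V t ⊓ T (n + 1)) ⊔ T n) =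
      fun n => (V t₀ ⊓ T (n + 1)) ⊔ T n := by
    refine exists_forall_ge_eq_of_isArtinian x (Submodule.torsionBySet R D I)
      (fun t n => (V t ⊓ T (n + 1)) ⊔ T n) ?_ ?_ ?_ ?_
    · intro t y hy n g hg
      obtain ⟨a, ha, b, hb, rfl⟩ := Submodule.mem_sup.mp hg
      rw [smul_add]
      exact Submodule.add_mem_sup ⟨Submodule.smul_mem _ _ ha.1,
        mem_torsionBySet_pow_succ.mp ha.2 y (hxI y hy)⟩
        (mem_torsionBySet_pow_succ.mp hb y (hxI y hy))
    · intro t t' h n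
      exact sup_le_sup_right (inf_le_inf_right _ (hV h)) _
    · intro t
      dsimp only [T]
      rw [torsionBySet_pow_zero, sup_bot_eq, zero_add, pow_one]
      exact inf_le_right
    · intro t n
      exact le_sup_right
  obtain ⟨t₀, ht₀⟩ := hstab
  refine ⟨t₀, fun t ht => ?_⟩
  change V t₀ = V t
  refine le_antisymm ?_ (hV ht)
  have key : ∀ n, V t₀ ⊓ T n ≤ V t := by
    intro n
    induction n with
    | zero => simp [T, torsionBySet_pow_zero]
    | succ n ih =>
      rintro g hg
      have h1 : g ∈ (V t ⊓ T (n + 1)) ⊔ T n := by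
        rw [congrFun (ht₀ t ht) n]
        exact Submodule.mem_sup_left hg
      obtain ⟨a, ha, b, hb, rfl⟩ := Submodule.mem_sup.mp h1
      refine Submodule.add_mem _ ha.1 (ih ⟨?_, hb⟩)
      simpa using Submodule.sub_mem _ hg.1 (hV ht ha.1)
  intro g hg
  obtain ⟨n, hn⟩ := htors g
  exact key n ⟨hg, hn⟩

theorem loweringDCC_of_isArtinian [DecidableEq R] [IsArtinian R D] {d : ℕ} (x : Fin d → R)
    (A B : ℕ → Submodule R D)
    (hA : ∀ n, Submodule.torsionBySet R D (Ideal.span (Set.range x) ^ n : Ideal R) ≤ A n) :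
    LoweringDCC (Finset.univ.image x) A B := by
  intro G hG hAG _ hanti
  exact exists_forall_ge_eq_of_isArtinian x ⊤ G hG hanti (fun _ => le_top)
    fun t n => (hA n).trans (hAG t n)

end Artinian

section Polynomial

variable {R : Type*} [CommRing R] {D D' : Type*} [AddCommGroup D] [Module R D]
  [AddCommGroup D'] [Module R D']

theorem relativeLength_map_map (f : D →ₗ[R] D') (A B : Submodule R D) (hA : LinearMap.ker f ≤ A) :
    relativeLength (A.map f) (B.map f) = relativeLength A B := by
  rw [relativeLength_eq_length_range ((A.map f).mkQ ∘ₗ (B.map f).subtype) (fun b => by simp),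
    relativeLength_eq_length_range ((A.map f).mkQ ∘ₗ f ∘ₗ B.subtype) (fun b => ?_)]
  · have : LinearMap.range ((A.map f).mkQ ∘ₗ (B.map f).subtype) =
        LinearMap.range ((A.map f).mkQ ∘ₗ f ∘ₗ B.subtype) := by
      rw [LinearMap.range_comp, LinearMap.range_comp, LinearMap.range_comp,
        Submodule.range_subtype, Submodule.range_subtype]
    rw [this]
  · have : f b ∈ A.map f ↔ (b : D) ∈ A := by
      rw [← Submodule.mem_comap, Submodule.comap_map_eq, sup_eq_left.mpr hA]
    simpa using this

/-- For a linear map of Artinian modules `f : D' → D`, the length of the cokernel of the map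
between annihilators of `I ^ n` is eventually polynomial as soon as it is eventually finite. -/
theorem isEventuallyPolynomial_torsionBySet {I : Ideal R} (hI : I.FG) [IsArtinian R D]
    [IsArtinian R D'] (f : D' →ₗ[R] D)
    (hfin : ∃ N₀, ∀ n ≥ N₀, relativeLength
      ((Submodule.torsionBySet R D' (I ^ n : Ideal R)).map f)
      (Submodule.torsionBySet R D (I ^ n : Ideal R)) ≠ ⊤) :
    IsEventuallyPolynomial fun n => relativeLength
      ((Submodule.torsionBySet R D' (I ^ n : Ideal R)).map f)
      (Submodule.torsionBySet R D (I ^ n : Ideal R)) := by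
  classical
  obtain ⟨d, x, rfl⟩ := Submodule.fg_iff_exists_fin_generating_family.mp hI
  set I := Submodule.span R (Set.range x) with hIdef
  have hxI : ∀ y ∈ Finset.univ.image x, y ∈ I := by
    intro y hy
    obtain ⟨i, -, rfl⟩ := Finset.mem_image.mp hy
    exact Submodule.subset_span ⟨i, rfl⟩
  let T : ℕ → Submodule R D := fun n => Submodule.torsionBySet R D (I ^ n : Ideal R)
  let T' : ℕ → Submodule R D' := fun n => Submodule.torsionBySet R D' (I ^ n : Ideal R)
  have hT : Monotone T := torsionBySet_pow_mono I
  have hT's : IsLowering (Finset.univ.image x) T' := fun y hy n g hg =>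
    mem_torsionBySet_pow_succ.mp hg y (hxI y hy)
  have hTs : IsLowering (Finset.univ.image x) T := fun y hy n g hg =>
    mem_torsionBySet_pow_succ.mp hg y (hxI y hy)
  have hmapT : ∀ n, (T' n).map f ≤ T n := by
    rintro n _ ⟨g, hg, rfl⟩
    simp only [T, T', Submodule.mem_torsionBySet_iff, SetLike.mem_coe] at hg ⊢
    intro a
    rw [← map_smul, hg a, map_zero]
  obtain ⟨N₀, hN₀⟩ := hfin
  let B := LinearMap.range f
  have h1 : ∀ n, (T' n).map f ≤ T n ⊓ B := fun n =>
    le_inf (hmapT n) (LinearMap.map_le_range)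
  have hsplit : ∀ n, relativeLength ((T' n).map f) (T n) =
      relativeLength ((T' n).map f) (T n ⊓ B) + relativeLength (T n ⊓ B) (T n) := fun n =>
    relativeLength_add (h1 n) inf_le_left
  have p1 : IsEventuallyPolynomial fun n => relativeLength ((T' n).map f) (T n ⊓ B) := by
    have heq : ∀ n, relativeLength ((T' n).map f) (T n ⊓ B) =
        relativeLength (T' n ⊔ LinearMap.ker f) ((T n).comap f) := by
      intro n
      rw [← relativeLength_map_map f _ _ le_sup_right, Submodule.map_sup, Submodule.map_comap_eq]
      have : Submodule.map f (LinearMap.ker f) = ⊥ := LinearMap.le_ker_iff_map.mp le_rfl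
      rw [this, sup_bot_eq, inf_comm]
    simp only [heq]
    refine isEventuallyPolynomial_relativeLength (Finset.univ.image x) _ _ ?_ ?_ ?_
      (loweringDCC_of_isArtinian x _ _ fun n => le_sup_left) ⟨N₀, fun n hn => ?_⟩
    · intro y hy n g hg
      obtain ⟨a, ha, b, hb, rfl⟩ := Submodule.mem_sup.mp hg
      rw [smul_add]
      exact Submodule.add_mem_sup (hT's y hy n a ha) (Submodule.smul_mem _ _ hb)
    · intro y hy n g hg
      rw [Submodule.mem_comap, map_smul]
      exact hTs y hy n _ hg
    · refine fun n => sup_le (Submodule.map_le_iff_le_comap.mp (hmapT n)) ?_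
      exact Submodule.comap_mono bot_le
    · rw [← heq]
      exact ne_top_of_le_ne_top (hN₀ n hn) (relativeLength_le_left (h1 n) inf_le_left)
  have p2 : IsEventuallyPolynomial fun n => relativeLength (T n ⊓ B) (T n) := by
    have heq : ∀ n, relativeLength (T n ⊓ B) (T n) = relativeLength B (B ⊔ T n) := by
      intro n
      have := relativeLength_map (LinearMap.id (R := R) (M := D)) (T n) B
      simpa using this
    have hfin2 : ∀ n ≥ N₀, relativeLength (T n ⊓ B) (T n) ≠ ⊤ := fun n hn =>
      ne_top_of_le_ne_top (hN₀ n hn) (relativeLength_le_right (h1 n) inf_le_left)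
    have p3 : IsEventuallyPolynomial fun n => relativeLength (B ⊔ T n) (B ⊔ T (n + 1)) := by
      refine isEventuallyPolynomial_relativeLength (Finset.univ.image x) _ (fun n => B ⊔ T (n + 1))
        ?_ ?_ (fun n => sup_le_sup_left (hT (Nat.le_succ n)) _)
        (loweringDCC_of_isArtinian x _ _ fun n => le_sup_right) ⟨N₀, fun n hn => ?_⟩
      · intro y hy n g hg
        obtain ⟨a, ha, b, hb, rfl⟩ := Submodule.mem_sup.mp hg
        rw [smul_add]
        exact Submodule.add_mem_sup (Submodule.smul_mem _ _ ha) (hTs y hy n b hb)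
      · intro y hy n g hg
        obtain ⟨a, ha, b, hb, rfl⟩ := Submodule.mem_sup.mp hg
        rw [smul_add]
        exact Submodule.add_mem_sup (Submodule.smul_mem _ _ ha) (hTs y hy (n + 1) b hb)
      · refine ne_top_of_le_ne_top (hfin2 (n + 1) (by omega)) ?_
        rw [heq]
        exact relativeLength_le_right le_sup_left (sup_le_sup_left (hT (Nat.le_succ n)) _)
    refine IsEventuallyPolynomial.of_succ_add (c := 0) ⟨N₀, hfin2⟩ p3
      ⟨0, 0, fun n _ => ⟨0, by simp, by simp⟩⟩ fun n => ?_
    rw [heq, heq, relativeLength_add (A := B) (B := B ⊔ T n) (C := B ⊔ T (n + 1)) le_sup_left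
      (sup_le_sup_left (hT (Nat.le_succ n)) _)]
    simp
  exact (p1.add p2).congr ⟨0, fun n _ => hsplit n⟩

end Polynomial

section ExtComputation

theorem nonempty_linearEquiv_of_surjective {R W A B : Type*} [Ring R] [AddCommGroup W]
    [AddCommGroup A] [AddCommGroup B] [Module R W] [Module R A] [Module R B] (f : W →ₗ[R] A)
    (g : W →ₗ[R] B) (hf : Function.Surjective f) (hg : Function.Surjective g)
    (h : ∀ w, f w = 0 ↔ g w = 0) : Nonempty (A ≃ₗ[R] B) := by
  have hk : LinearMap.ker f = LinearMap.ker g := by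
    ext w
    exact h w
  exact ⟨(f.quotKerEquivOfSurjective hf).symm ≪≫ₗ Submodule.quotEquivOfEq _ _ hk ≪≫ₗ
    g.quotKerEquivOfSurjective hg⟩

variable {R : Type u} [CommRing R]

theorem exists_surjective_cocycles_extModule {X Y : Type u} [AddCommGroup X] [Module R X]
    [AddCommGroup Y] [Module R Y] (P : ProjectiveResolution (ModuleCat.of R X)) {i n : ℕ}
    (hi : (ComplexShape.up ℕ).prev n = i) :
    ∃ f : LinearMap.ker (LinearMap.lcomp R Y (P.complex.d (n + 1) n).hom) →ₗ[R] extModule R n X Y,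
      Function.Surjective f ∧
        ∀ w, f w = 0 ↔ ∃ v : P.complex.X i →ₗ[R] Y, v ∘ₗ (P.complex.d n i).hom = w := by
  let K := P.complex.linearYonedaObj R (ModuleCat.of R Y)
  let S := K.sc' i n (n + 1)
  let φ : extModule R n X Y ≃ₗ[R]
      (LinearMap.ker S.g.hom ⧸ LinearMap.range S.moduleCatToCycles) :=
    (P.isoExt n (ModuleCat.of R Y) ≪≫
      K.homologyIsoSc' i n (n + 1) hi (by simp) ≪≫ S.moduleCatHomologyIso).toLinearEquiv
  let ψ : LinearMap.ker (LinearMap.lcomp R Y (P.complex.d (n + 1) n).hom) →ₗ[R]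
      LinearMap.ker S.g.hom :=
    ((ModuleCat.homLinearEquiv (S := R) (M := P.complex.X n)
      (N := ModuleCat.of R Y)).symm.toLinearMap ∘ₗ Submodule.subtype _).codRestrict _ (by
        rintro ⟨w, hw⟩
        change P.complex.d (n + 1) n ≫ ModuleCat.ofHom w = 0
        ext1
        exact hw)
  have hψ : Function.Surjective ψ := by
    rintro ⟨z, hz⟩
    change P.complex.X n ⟶ ModuleCat.of R Y at z
    refine ⟨⟨z.hom, ?_⟩, ?_⟩
    · exact congrArg ModuleCat.Hom.hom (show P.complex.d (n + 1) n ≫ z = 0 from hz)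
    · rfl
  refine ⟨φ.symm.toLinearMap ∘ₗ (LinearMap.range S.moduleCatToCycles).mkQ ∘ₗ ψ,
    φ.symm.surjective.comp ((Submodule.mkQ_surjective _).comp hψ), fun w => ?_⟩
  simp only [LinearMap.comp_apply, LinearEquiv.coe_coe, LinearEquiv.map_eq_zero_iff,
    Submodule.mkQ_apply, Submodule.Quotient.mk_eq_zero, LinearMap.mem_range]
  constructor
  · rintro ⟨v, hv⟩
    change P.complex.X i ⟶ ModuleCat.of R Y at v
    exact ⟨v.hom, congrArg ModuleCat.Hom.hom
      (show P.complex.d n i ≫ v = ModuleCat.ofHom w.1 from congrArg Subtype.val hv)⟩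
  · rintro ⟨v, hv⟩
    refine ⟨(ModuleCat.ofHom v : P.complex.X i ⟶ ModuleCat.of R Y), Subtype.ext ?_⟩
    change P.complex.d n i ≫ ModuleCat.ofHom v = ModuleCat.ofHom w.1
    ext1
    exact hv

theorem range_d_succ_eq_ker {X : Type u} [AddCommGroup X] [Module R X]
    (P : ProjectiveResolution (ModuleCat.of R X)) (n : ℕ) :
    LinearMap.range (P.complex.d (n + 2) (n + 1)).hom =
      LinearMap.ker (P.complex.d (n + 1) n).hom :=
  (P.exact_succ n).moduleCat_range_eq_ker

theorem exists_augmentation {X : Type u} [AddCommGroup X] [Module R X]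
    (P : ProjectiveResolution (ModuleCat.of R X)) :
    ∃ ε : P.complex.X 0 →ₗ[R] X, Function.Surjective ε ∧
      LinearMap.range (P.complex.d 1 0).hom = LinearMap.ker ε :=
  ⟨(P.π.f 0).hom, (ModuleCat.epi_iff_surjective _).mp inferInstance,
    P.exact₀.moduleCat_range_eq_ker⟩

/-- A linear map vanishing on the kernel of a surjection factors through it. -/
theorem exists_comp_eq_of_ker_le {A B Y : Type*} [AddCommGroup A] [Module R A] [AddCommGroup B]
    [Module R B] [AddCommGroup Y] [Module R Y] (p : A →ₗ[R] B) (hp : Function.Surjective p)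
    (f : A →ₗ[R] Y) (h : LinearMap.ker p ≤ LinearMap.ker f) : ∃ g : B →ₗ[R] Y, g ∘ₗ p = f := by
  refine ⟨(LinearMap.ker p).liftQ f h ∘ₗ (p.quotKerEquivOfSurjective hp).symm.toLinearMap, ?_⟩
  ext a
  have : (p.quotKerEquivOfSurjective hp).symm (p a) = Submodule.Quotient.mk a := by
    rw [LinearEquiv.symm_apply_eq]
    rfl
  simp [this]

/-- Left exactness of `Hom(-, Y)`. -/
theorem exists_linearEquiv_ker_lcomp {P₁ P₀ X : Type*} [AddCommGroup P₁] [Module R P₁]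
    [AddCommGroup P₀] [Module R P₀] [AddCommGroup X] [Module R X] (d : P₁ →ₗ[R] P₀) (ε : P₀ →ₗ[R] X)
    (hε : Function.Surjective ε) (hker : LinearMap.range d = LinearMap.ker ε) (Y : Type*)
    [AddCommGroup Y] [Module R Y] :
    ∃ e : (X →ₗ[R] Y) ≃ₗ[R] LinearMap.ker (LinearMap.lcomp R Y d),
      ∀ w, (e w : P₀ →ₗ[R] Y) = w ∘ₗ ε := by
  let g : (X →ₗ[R] Y) →ₗ[R] LinearMap.ker (LinearMap.lcomp R Y d) :=
    (LinearMap.lcomp R Y ε).codRestrict _ fun w => by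
      ext x
      have : d x ∈ LinearMap.ker ε := hker ▸ LinearMap.mem_range_self _ _
      simp [LinearMap.mem_ker.mp this]
  refine ⟨LinearEquiv.ofBijective g ⟨?_, ?_⟩, fun w => rfl⟩
  · intro v w h
    ext x
    obtain ⟨y, rfl⟩ := hε x
    exact LinearMap.congr_fun (congrArg Subtype.val h) y
  · rintro ⟨w, hw⟩
    obtain ⟨v, hv⟩ := exists_comp_eq_of_ker_le ε hε w (by
      rw [← hker]
      rintro _ ⟨x, rfl⟩
      exact LinearMap.congr_fun hw x)
    exact ⟨v, Subtype.ext hv⟩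

theorem nonempty_extModule_zero_linearEquiv (X Y : Type u) [AddCommGroup X] [Module R X]
    [AddCommGroup Y] [Module R Y] : Nonempty (extModule R 0 X Y ≃ₗ[R] (X →ₗ[R] Y)) := by
  let P := projectiveResolution (ModuleCat.of R X)
  obtain ⟨f, hf, hf0⟩ := exists_surjective_cocycles_extModule (Y := Y) P (i := 0) (n := 0) (by simp)
  obtain ⟨ε, hε, hker⟩ := exists_augmentation P
  obtain ⟨e, -⟩ := exists_linearEquiv_ker_lcomp _ _ hε hker Y
  refine nonempty_linearEquiv_of_surjective f e.symm.toLinearMap hf e.symm.surjective fun w => ?_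
  have hd : P.complex.d 0 0 = 0 := P.complex.shape _ _ (by simp)
  rw [hf0]
  simp only [hd, ModuleCat.hom_zero, LinearMap.comp_zero, exists_const]
  rw [eq_comm, ZeroMemClass.coe_eq_zero]
  exact (LinearEquiv.map_eq_zero_iff e.symm).symm

section Shift

variable {M E M' : Type u} [AddCommGroup M] [Module R M] [AddCommGroup E] [Module R E]
  [AddCommGroup M'] [Module R M'] {π : E →ₗ[R] M'} {ι : M →ₗ[R] E}

/-- Dimension shifting along a short exact sequence with injective middle term, for a complex of
projective modules `P₂ → P₁ → P₀ → Q`. -/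
theorem exists_surjective_shift (hE : Module.Injective R E) (hι : Function.Injective ι)
    (hπ : Function.Surjective π) (hιπ : LinearMap.range ι = LinearMap.ker π)
    {P₂ P₁ P₀ Q : Type u} [AddCommGroup P₂] [Module R P₂] [AddCommGroup P₁] [Module R P₁]
    [AddCommGroup P₀] [Module R P₀] [AddCommGroup Q] [Module R Q] [Module.Projective R P₀]
    (d₂ : P₂ →ₗ[R] P₁) (d₁ : P₁ →ₗ[R] P₀) (d₀ : P₀ →ₗ[R] Q)
    (h₁ : LinearMap.range d₂ = LinearMap.ker d₁) (h₀ : LinearMap.range d₁ = LinearMap.ker d₀) :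
    ∃ (V : Type u) (_ : AddCommGroup V) (_ : Module R V)
      (F : V →ₗ[R] LinearMap.ker (LinearMap.lcomp R M d₂))
      (G : V →ₗ[R] LinearMap.ker (LinearMap.lcomp R M' d₁)),
      Function.Surjective F ∧ Function.Surjective G ∧
        ∀ v, (∃ k : P₀ →ₗ[R] M, k ∘ₗ d₁ = F v) ↔ ∃ e : Q →ₗ[R] E, π ∘ₗ e ∘ₗ d₀ = G v := by
  have hd₁ : d₁ ∘ₗ d₂ = 0 := by
    ext x
    exact (h₁ ▸ LinearMap.mem_range_self _ _ : d₂ x ∈ LinearMap.ker d₁)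
  have hd₀ : d₀ ∘ₗ d₁ = 0 := by
    ext x
    exact (h₀ ▸ LinearMap.mem_range_self _ _ : d₁ x ∈ LinearMap.ker d₀)
  have hπι : π ∘ₗ ι = 0 := by
    ext x
    exact (hιπ ▸ LinearMap.mem_range_self _ _ : ι x ∈ LinearMap.ker π)
  let V : Submodule R ((P₀ →ₗ[R] E) × (P₁ →ₗ[R] M)) :=
    LinearMap.ker (LinearMap.lcomp R E d₁ ∘ₗ LinearMap.fst R _ _ -
      LinearMap.compRight R ι ∘ₗ LinearMap.snd R _ _)
  have hV : ∀ v, v ∈ V ↔ v.1 ∘ₗ d₁ = ι ∘ₗ v.2 := fun v => sub_eq_zero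
  let F : V →ₗ[R] LinearMap.ker (LinearMap.lcomp R M d₂) :=
    (LinearMap.snd R _ _ ∘ₗ V.subtype).codRestrict _ (by
      rintro ⟨v, hv⟩
      rw [hV] at hv
      refine (LinearMap.cancel_left hι).mp ?_
      change (ι ∘ₗ v.2) ∘ₗ d₂ = _
      rw [← hv, LinearMap.comp_assoc, hd₁]
      simp)
  let G : V →ₗ[R] LinearMap.ker (LinearMap.lcomp R M' d₁) :=
    (LinearMap.compRight R π ∘ₗ LinearMap.fst R _ _ ∘ₗ V.subtype).codRestrict _ (by
      rintro ⟨v, hv⟩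
      rw [hV] at hv
      change π ∘ₗ (v.1 ∘ₗ d₁) = 0
      rw [hv, ← LinearMap.comp_assoc, hπι, LinearMap.zero_comp])
  have hlift : ∀ {P : Type u} [AddCommGroup P] [Module R P] (f : P →ₗ[R] E), π ∘ₗ f = 0 →
      ∃ k : P →ₗ[R] M, ι ∘ₗ k = f := by
    intro P _ _ f hf
    let e := LinearEquiv.ofInjective ι hι
    refine ⟨e.symm.toLinearMap ∘ₗ f.codRestrict (LinearMap.range ι) fun x => ?_, ?_⟩
    · rw [hιπ]
      exact LinearMap.congr_fun hf x
    · ext x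
      exact congrArg Subtype.val (e.apply_symm_apply _)
  have hext : ∀ {A B C : Type u} [AddCommGroup A] [Module R A] [AddCommGroup B] [Module R B]
      [AddCommGroup C] [Module R C] (a : A →ₗ[R] B) (b : B →ₗ[R] C)
      (hab : LinearMap.range a = LinearMap.ker b) (f : B →ₗ[R] E), f ∘ₗ a = 0 →
      ∃ g : C →ₗ[R] E, g ∘ₗ b = f := by
    intro A B C _ _ _ _ _ _ a b hab f hf
    obtain ⟨g, hg⟩ := exists_comp_eq_of_ker_le b.rangeRestrict b.surjective_rangeRestrict f (by
      rw [LinearMap.ker_rangeRestrict, ← hab]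
      rintro _ ⟨x, rfl⟩
      exact LinearMap.congr_fun hf x)
    obtain ⟨g', hg'⟩ := hE.out (LinearMap.range b).subtype Subtype.val_injective g
    refine ⟨g', ?_⟩
    rw [← hg]
    ext x
    exact hg' (b.rangeRestrict x)
  refine ⟨V, inferInstance, inferInstance, F, G, ?_, ?_, ?_⟩
  · rintro ⟨w, hw⟩
    replace hw : w ∘ₗ d₂ = 0 := hw
    obtain ⟨g, hg⟩ := hext d₂ d₁ h₁ (ι ∘ₗ w) (by rw [LinearMap.comp_assoc, hw, LinearMap.comp_zero])
    exact ⟨⟨(g, w), (hV _).mpr hg⟩, rfl⟩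
  · rintro ⟨w, hw⟩
    replace hw : w ∘ₗ d₁ = 0 := hw
    obtain ⟨g, hg⟩ := Module.projective_lifting_property π w hπ
    obtain ⟨k, hk⟩ := hlift (g ∘ₗ d₁) (by rw [← LinearMap.comp_assoc, hg, hw])
    exact ⟨⟨(g, k), (hV _).mpr hk.symm⟩, Subtype.ext hg⟩
  · rintro ⟨⟨g, w⟩, hv⟩
    replace hv : g ∘ₗ d₁ = ι ∘ₗ w := (hV _).mp hv
    change (∃ k : P₀ →ₗ[R] M, k ∘ₗ d₁ = w) ↔ ∃ e : Q →ₗ[R] E, π ∘ₗ e ∘ₗ d₀ = π ∘ₗ g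
    constructor
    · rintro ⟨k, hk⟩
      obtain ⟨e, he⟩ := hext d₁ d₀ h₀ (g - ι ∘ₗ k) (by
        rw [LinearMap.sub_comp, hv, LinearMap.comp_assoc, hk, sub_self])
      refine ⟨e, ?_⟩
      rw [he, LinearMap.comp_sub, ← LinearMap.comp_assoc, hπι, LinearMap.zero_comp, sub_zero]
    · rintro ⟨e, he⟩
      obtain ⟨k, hk⟩ := hlift (g - e ∘ₗ d₀) (by rw [LinearMap.comp_sub, he, sub_self])
      refine ⟨k, (LinearMap.cancel_left hι).mp ?_⟩
      rw [← LinearMap.comp_assoc, hk, LinearMap.sub_comp, LinearMap.comp_assoc, hd₀,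
        LinearMap.comp_zero, sub_zero, hv]

/-- `Ext¹(X, M)` is the cokernel of `Hom(X, E) → Hom(X, M')` for a short exact sequence
`0 → M → E → M' → 0` with `E` injective. -/
theorem nonempty_extModule_one_linearEquiv (hE : Module.Injective R E) (hι : Function.Injective ι)
    (hπ : Function.Surjective π) (hιπ : LinearMap.range ι = LinearMap.ker π)
    (X : Type u) [AddCommGroup X] [Module R X] :
    Nonempty (extModule R 1 X M ≃ₗ[R]
      ((X →ₗ[R] M') ⧸ LinearMap.range
        (LinearMap.compRight R π : (X →ₗ[R] E) →ₗ[R] X →ₗ[R] M'))) := by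
  let P := projectiveResolution (ModuleCat.of R X)
  have : ∀ n, Module.Projective R (P.complex.X n) := fun n =>
    (IsProjective.iff_projective _).mpr (P.projective n)
  obtain ⟨ε, hε, hker⟩ := exists_augmentation P
  obtain ⟨V, _, _, F, G, hF, hG, hFG⟩ := exists_surjective_shift hE hι hπ hιπ _ _ _
    (range_d_succ_eq_ker P 0) hker
  obtain ⟨f, hf, hf0⟩ := exists_surjective_cocycles_extModule (Y := M) P (i := 0) (n := 1) (by simp)
  obtain ⟨e, he⟩ := exists_linearEquiv_ker_lcomp _ _ hε hker M'
  let q : (X →ₗ[R] M') →ₗ[R] _ := (LinearMap.range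
    (LinearMap.compRight R π : (X →ₗ[R] E) →ₗ[R] X →ₗ[R] M')).mkQ
  refine nonempty_linearEquiv_of_surjective (f ∘ₗ F) (q ∘ₗ e.symm.toLinearMap ∘ₗ G) (hf.comp hF)
    ((Submodule.mkQ_surjective _).comp (e.symm.surjective.comp hG)) fun v => ?_
  rw [LinearMap.comp_apply, hf0, hFG]
  simp only [q, LinearMap.comp_apply, Submodule.mkQ_apply, Submodule.Quotient.mk_eq_zero,
    LinearMap.mem_range]
  refine exists_congr fun w => ?_
  change _ ↔ _ = e.symm (G v)
  rw [LinearEquiv.eq_symm_apply, Subtype.ext_iff, he]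
  rfl

theorem nonempty_extModule_succ_linearEquiv (hE : Module.Injective R E)
    (hι : Function.Injective ι) (hπ : Function.Surjective π)
    (hιπ : LinearMap.range ι = LinearMap.ker π) (n : ℕ) (X : Type u) [AddCommGroup X]
    [Module R X] : Nonempty (extModule R (n + 2) X M ≃ₗ[R] extModule R (n + 1) X M') := by
  let P := projectiveResolution (ModuleCat.of R X)
  have : ∀ n, Module.Projective R (P.complex.X n) := fun n =>
    (IsProjective.iff_projective _).mpr (P.projective n)
  obtain ⟨V, _, _, F, G, hF, hG, hFG⟩ := exists_surjective_shift hE hι hπ hιπ _ _ _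
    (range_d_succ_eq_ker P (n + 1)) (range_d_succ_eq_ker P n)
  obtain ⟨f, hf, hf0⟩ := exists_surjective_cocycles_extModule (Y := M) P (i := n + 1)
    (n := n + 2) (by simp)
  obtain ⟨f', hf', hf0'⟩ := exists_surjective_cocycles_extModule (Y := M') P (i := n)
    (n := n + 1) (by simp)
  refine nonempty_linearEquiv_of_surjective (f ∘ₗ F) (f' ∘ₗ G) (hf.comp hF)
    (hf'.comp hG) fun v => ?_
  rw [LinearMap.comp_apply, LinearMap.comp_apply, hf0, hf0', hFG]
  constructor
  · rintro ⟨w, hw⟩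
    exact ⟨π ∘ₗ w, hw⟩
  · rintro ⟨w, hw⟩
    obtain ⟨w', rfl⟩ := Module.projective_lifting_property π w hπ
    exact ⟨w', hw⟩

end Shift

end ExtComputation

section InjectiveHull

theorem exists_maximal_disjoint {R Q : Type*} [Ring R] [AddCommGroup Q] [Module R Q]
    (A B : Submodule R Q) (h : Disjoint B A) :
    ∃ K, B ≤ K ∧ Maximal (fun K => Disjoint K A) K := by
  refine zorn_le_nonempty₀ {K | Disjoint K A} (fun c hc hchain K hK => ?_) B h
  refine ⟨sSup c, ?_, fun z hz => le_sSup hz⟩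
  exact (hchain.directedOn.disjoint_sSup_left).mpr fun z hz => hc hz

variable {R : Type u} [CommRing R]

theorem Module.Injective.of_retract {Q E : Type u} [AddCommGroup Q] [Module R Q] [AddCommGroup E]
    [Module R E] (hQ : Module.Injective R Q) (s : E →ₗ[R] Q) (r : Q →ₗ[R] E)
    (hrs : ∀ x, r (s x) = x) : Module.Injective R E where
  out X Y _ _ _ _ f hf g := by
    obtain ⟨h, hh⟩ := hQ.out f hf (s ∘ₗ g)
    exact ⟨r ∘ₗ h, fun x => by rw [LinearMap.comp_apply, hh, LinearMap.comp_apply, hrs]⟩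

theorem exists_injective_embedding (M : Type u) [AddCommGroup M] [Module R M] :
    ∃ (Q : Type u) (_ : AddCommGroup Q) (_ : Module R Q) (j : M →ₗ[R] Q),
      Module.Injective R Q ∧ Function.Injective j := by
  obtain ⟨⟨J, hJ, f, hf⟩⟩ := EnoughInjectives.presentation (ModuleCat.of R M)
  exact ⟨J, inferInstance, inferInstance, f.hom, Module.injective_module_of_injective_object R J,
    (ModuleCat.mono_iff_injective f).mp hf⟩

/-- Every module embeds as an essential submodule in an injective module. -/
theorem exists_injective_hull (M : Type u) [AddCommGroup M] [Module R M] :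
    ∃ (E : Type u) (_ : AddCommGroup E) (_ : Module R E) (ι : M →ₗ[R] E),
      Module.Injective R E ∧ Function.Injective ι ∧
        ∀ x : E, x ≠ 0 → ∃ r : R, r • x ≠ 0 ∧ r • x ∈ LinearMap.range ι := by
  obtain ⟨Q, _, _, j, hQ, hj⟩ := exists_injective_embedding (R := R) M
  obtain ⟨K, -, hK⟩ := exists_maximal_disjoint (LinearMap.range j) ⊥ disjoint_bot_left
  obtain ⟨E, hME, hE⟩ := exists_maximal_disjoint K (LinearMap.range j) hK.prop.symm
  have hEK : Disjoint E K := hE.prop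
  have hinj : Function.Injective (K.mkQ ∘ₗ E.subtype) := by
    rw [← LinearMap.ker_eq_bot, LinearMap.ker_comp, Submodule.ker_mkQ, eq_bot_iff]
    intro x hx
    exact Subtype.ext (Submodule.disjoint_def.mp hEK x x.2 hx)
  have hess : ∀ U : Submodule R (Q ⧸ K), Disjoint U (E.map K.mkQ) → U = ⊥ := by
    intro U hU
    have h1 : Disjoint (U.comap K.mkQ) E := by
      refine Submodule.disjoint_def.mpr fun x hx hxE => ?_
      have : K.mkQ x = 0 := Submodule.disjoint_def.mp hU _ hx (Submodule.mem_map_of_mem hxE)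
      exact Submodule.disjoint_def.mp hEK x hxE (by simpa using this)
    have h2 : U.comap K.mkQ ≤ K := hK.le_of_ge (h1.mono_right hME) (Submodule.le_comap_mkQ K U)
    rw [eq_bot_iff]
    intro y hy
    obtain ⟨x, rfl⟩ := K.mkQ_surjective y
    simpa using h2 hy
  obtain ⟨φ, hφ⟩ := hQ.out (K.mkQ ∘ₗ E.subtype) hinj E.subtype
  have hφE : ∀ x ∈ E, φ (K.mkQ x) = x := fun x hx => hφ ⟨x, hx⟩
  have hrange : LinearMap.range φ = E := by
    refine le_antisymm (hE.le_of_ge ?_ ?_) ?_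
    · have h1 : K.comap φ = ⊥ := by
        refine hess _ (Submodule.disjoint_def.mpr ?_)
        rintro _ hy ⟨x, hx, rfl⟩
        rw [Submodule.mem_comap, hφE x hx] at hy
        rw [Submodule.disjoint_def.mp hEK x hx hy, map_zero]
      refine Submodule.disjoint_def.mpr ?_
      rintro _ ⟨y, rfl⟩ hy
      have : y ∈ K.comap φ := hy
      rw [h1, Submodule.mem_bot] at this
      rw [this, map_zero]
    all_goals exact fun x hx => ⟨K.mkQ x, hφE x hx⟩
  let r : Q →ₗ[R] E := (φ ∘ₗ K.mkQ).codRestrict E fun x => hrange ▸ LinearMap.mem_range_self φ _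
  refine ⟨E, inferInstance, inferInstance, j.codRestrict E fun x => hME ⟨x, rfl⟩,
    hQ.of_retract E.subtype r fun x => Subtype.ext (hφE x x.2), fun a b hab =>
    hj (congrArg Subtype.val hab), fun x hx => ?_⟩
  by_contra! hcon
  have hdisj : Disjoint (Submodule.span R {(x : Q)}) (LinearMap.range j) := by
    refine Submodule.disjoint_def.mpr fun y hy hyj => ?_
    obtain ⟨r, rfl⟩ := Submodule.mem_span_singleton.mp hy
    by_contra hne
    obtain ⟨m, hm⟩ := hyj
    exact hcon r (fun h => hne (congrArg Subtype.val h)) ⟨m, Subtype.ext hm⟩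
  have hxE : Submodule.span R {(x : Q)} ≤ E := by simp
  have h2 : Submodule.span R {(x : Q)} ≤ K := by
    refine le_sup_right.trans (hK.le_of_ge (y := K ⊔ Submodule.span R {(x : Q)}) ?_ le_sup_left)
    refine Submodule.disjoint_def.mpr fun y hy hyj => ?_
    obtain ⟨k, hk, w, hw, rfl⟩ := Submodule.mem_sup.mp hy
    have hkE : k ∈ E := by simpa using E.sub_mem (hME hyj) (hxE hw)
    obtain rfl := Submodule.disjoint_def.mp hEK k hkE hk
    rw [zero_add] at hyj ⊢
    exact Submodule.disjoint_def.mp hdisj w hw hyj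
  exact hx (Subtype.ext (Submodule.disjoint_def.mp hEK x x.2
    (h2 (Submodule.mem_span_singleton_self _))))

end InjectiveHull

section Essential

variable {R : Type*} [CommRing R] {M E : Type*} [AddCommGroup M] [Module R M] [AddCommGroup E]
  [Module R E] {ι : M →ₗ[R] E}

theorem torsionBySet_le_range_of_essential
    (hess : ∀ x : E, x ≠ 0 → ∃ r : R, r • x ≠ 0 ∧ r • x ∈ LinearMap.range ι) (P : Ideal R)
    [hP : P.IsMaximal] : Submodule.torsionBySet R E P ≤ LinearMap.range ι := by
  intro x hx
  rw [Submodule.mem_torsionBySet_iff] at hx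
  by_cases hx0 : x = 0
  · simp [hx0]
  obtain ⟨r, hr, hrM⟩ := hess x hx0
  have hrP : r ∉ P := fun h => hr (hx ⟨r, h⟩)
  obtain ⟨s, a, ha, hs⟩ := hP.exists_inv hrP
  have : x = s • r • x := by
    have h1 : a • x = 0 := hx ⟨a, ha⟩
    rw [smul_smul, ← add_zero ((s * r) • x), ← h1, ← add_smul, hs, one_smul]
  rw [this]
  exact Submodule.smul_mem _ _ hrM

theorem isArtinian_torsionBySet_of_essential (hι : Function.Injective ι)
    (hess : ∀ x : E, x ≠ 0 → ∃ r : R, r • x ≠ 0 ∧ r • x ∈ LinearMap.range ι) (P : Ideal R)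
    [P.IsMaximal] (h : IsArtinian R (Submodule.torsionBySet R M P)) :
    IsArtinian R (Submodule.torsionBySet R E P) := by
  have hle : Submodule.torsionBySet R E P ≤ (Submodule.torsionBySet R M P).map ι := by
    intro x hx
    obtain ⟨y, rfl⟩ := torsionBySet_le_range_of_essential hess P hx
    refine ⟨y, ?_, rfl⟩
    simp only [SetLike.mem_coe, Submodule.mem_torsionBySet_iff] at hx ⊢
    exact fun a => hι (by rw [map_smul, hx a, map_zero])
  have : IsArtinian R ((Submodule.torsionBySet R M P).map ι) :=
    isArtinian_of_surjective _ (ι.submoduleMap _) (ι.submoduleMap_surjective _)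
  exact isArtinian_of_le hle

theorem support_subset_of_essential [IsNoetherianRing R]
    (hess : ∀ x : E, x ≠ 0 → ∃ r : R, r • x ≠ 0 ∧ r • x ∈ LinearMap.range ι) :
    Module.support R E ⊆ Module.support R M := by
  intro P hP
  by_contra hPM
  rw [Module.notMem_support_iff'] at hPM
  obtain ⟨x, hx⟩ := Module.mem_support_iff_exists_annihilator.mp hP
  obtain ⟨_, ⟨y, hyP, rfl⟩, hmax⟩ := set_has_maximal_iff_noetherian.mpr
    (inferInstanceAs (IsNoetherian R R))
    {J : Ideal R | ∃ y : E, (Submodule.span R {y}).annihilator ≤ P.asIdeal ∧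
      J = (Submodule.span R {y}).annihilator} ⟨_, x, hx, rfl⟩
  have hy0 : y ≠ 0 := by
    rintro rfl
    exact P.2.ne_top (top_le_iff.mp (le_trans
      (by rw [Submodule.span_zero_singleton, Submodule.annihilator_bot]) hyP))
  obtain ⟨s, hs, m, hm⟩ := hess y hy0
  obtain ⟨t, ht, htm⟩ := hPM m
  have hle : (Submodule.span R {y}).annihilator ≤ (Submodule.span R {t • y}).annihilator := by
    intro a ha
    rw [Submodule.mem_annihilator_span_singleton] at ha ⊢
    rw [smul_comm, ha, smul_zero]
  have hle' : (Submodule.span R {t • y}).annihilator ≤ P.asIdeal := by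
    intro a ha
    rw [Submodule.mem_annihilator_span_singleton, smul_smul,
      ← Submodule.mem_annihilator_span_singleton] at ha
    exact (P.2.mem_or_mem (hyP ha)).resolve_right ht
  have hsmem : s ∈ (Submodule.span R {t • y}).annihilator := by
    rw [Submodule.mem_annihilator_span_singleton, smul_comm, ← hm, ← map_smul, htm, map_zero]
  refine hmax _ ⟨t • y, hle', rfl⟩ (lt_of_le_of_ne hle fun heq => hs ?_)
  rwa [← heq, Submodule.mem_annihilator_span_singleton] at hsmem

end Essential

section Local

variable {R : Type u} [CommRing R]

theorem exists_smul_eq_zero_of_fg {E : Type*} [AddCommGroup E] [Module R E] (S : Submonoid R)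
    {P : Ideal R} (hP : P.FG) (x : E) (h : ∀ a ∈ P, ∃ s ∈ S, s • a • x = 0) :
    ∃ s ∈ S, ∀ a ∈ P, a • s • x = 0 := by
  obtain ⟨T, rfl⟩ := hP
  have key : ∀ T' : Finset R, T' ⊆ T → ∃ s ∈ S, ∀ a ∈ T', a • s • x = 0 := by
    classical
    intro T'
    induction T' using Finset.induction_on with
    | empty => exact fun _ => ⟨1, S.one_mem, by simp⟩
    | insert a T' ha ih =>
      intro hT
      obtain ⟨s, hs, hsx⟩ := ih ((Finset.subset_insert _ _).trans hT)
      obtain ⟨t, ht, htx⟩ := h a (Submodule.subset_span (hT (Finset.mem_insert_self _ _)))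
      refine ⟨s * t, S.mul_mem hs ht, fun b hb => ?_⟩
      rcases Finset.mem_insert.mp hb with rfl | hb
      · rw [mul_smul, smul_comm b, smul_comm b, htx, smul_zero]
      · rw [mul_comm, mul_smul, smul_comm b, hsx b hb, smul_zero]
  obtain ⟨s, hs, hsx⟩ := key T subset_rfl
  refine ⟨s, hs, fun a ha => ?_⟩
  have : Submodule.span R (T : Set R) ≤ LinearMap.ker (LinearMap.toSpanSingleton R E (s • x)) :=
    Submodule.span_le.mpr fun a ha => by simpa using hsx a ha
  simpa using this ha

theorem isArtinian_of_exists_smul_eq {S T : Type*} [Ring S] [AddCommGroup T] [Module R T]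
    [Module S T] (h : ∀ (c : S) (z : T), ∃ r : R, c • z = r • z) [IsArtinian S T] :
    IsArtinian R T := by
  let e : Submodule R T → Submodule S T := fun W =>
    { W.toAddSubmonoid with
      smul_mem' := fun c z hz => by
        obtain ⟨r, hr⟩ := h c z
        rw [hr]
        exact W.smul_mem r hz }
  have he : StrictMono e := by
    intro W W' hW
    exact ⟨fun z hz => hW.1 hz, fun hle => hW.2 fun z hz => hle hz⟩
  exact he.wellFoundedLT

variable (P : Ideal R) [hPm : P.IsMaximal]

theorem exists_smul_eq_of_mem_torsionBySet {Y : Type*} [AddCommGroup Y] [Module R Y]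
    [Module (Localization.AtPrime P) Y] [IsScalarTower R (Localization.AtPrime P) Y]
    (c : Localization.AtPrime P) (z : Y)
    (hz : ∀ a ∈ IsLocalRing.maximalIdeal (Localization.AtPrime P), a • z = 0) :
    ∃ r : R, c • z = r • z := by
  obtain ⟨⟨a, s⟩, has⟩ := IsLocalization.surj P.primeCompl c
  obtain ⟨t, b, hb, hts⟩ := hPm.exists_inv s.2
  refine ⟨t * a, ?_⟩
  rw [← sub_eq_zero, ← algebraMap_smul (Localization.AtPrime P) (t * a), ← sub_smul]
  refine hz _ ?_
  have h1 : c - algebraMap R (Localization.AtPrime P) (t * a) =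
      c * algebraMap R (Localization.AtPrime P) b := by
    have : algebraMap R (Localization.AtPrime P) b = 1 -
        algebraMap R (Localization.AtPrime P) t * algebraMap R (Localization.AtPrime P) s := by
      rw [← map_mul, eq_sub_iff_add_eq', ← map_add, hts, map_one]
    rw [this, map_mul, ← has]
    ring
  rw [h1]
  exact Ideal.mul_mem_left _ _ ((IsLocalization.AtPrime.to_map_mem_maximal_iff _ P b).mpr hb)

theorem isArtinian_torsionBySet_of_isFiniteLength (Y : Type u) [AddCommGroup Y] [Module R Y]
    (h : IsFiniteLength (Localization.AtPrime P) (extModule (Localization.AtPrime P) 0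
      (IsLocalRing.ResidueField (Localization.AtPrime P)) (LocalizedModule P.primeCompl Y))) :
    IsArtinian R (Submodule.torsionBySet R Y P) := by
  let A := Localization.AtPrime P
  let κ := IsLocalRing.ResidueField A
  let Z := LocalizedModule P.primeCompl Y
  obtain ⟨e⟩ := nonempty_extModule_zero_linearEquiv (R := A) κ Z
  have hart : IsArtinian A (κ →ₗ[A] Z) :=
    (isFiniteLength_iff_isNoetherian_isArtinian.mp (e.isFiniteLength h)).2
  let ev : (κ →ₗ[A] Z) →ₗ[A] Z := LinearMap.applyₗ (1 : κ)
  have hr : IsArtinian A (LinearMap.range ev) :=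
    isArtinian_of_surjective _ ev.rangeRestrict ev.surjective_rangeRestrict
  let T : Submodule A Z := Submodule.torsionBySet A Z (IsLocalRing.maximalIdeal A)
  have hTz : ∀ z ∈ T, ∀ a ∈ IsLocalRing.maximalIdeal A, a • z = 0 := fun z hz a ha =>
    (Submodule.mem_torsionBySet_iff _ _).mp hz ⟨a, ha⟩
  have hT : T ≤ LinearMap.range ev := by
    intro z hz
    obtain ⟨g, hg⟩ := exists_comp_eq_of_ker_le (Algebra.linearMap A κ)
      IsLocalRing.residue_surjective (LinearMap.toSpanSingleton A Z z) (by
        intro a ha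
        have : a ∈ IsLocalRing.maximalIdeal A := (IsLocalRing.residue_eq_zero_iff a).mp ha
        simpa using hTz z hz a this)
    refine ⟨g, ?_⟩
    have := LinearMap.congr_fun hg 1
    change g 1 = z
    simpa using this
  have hTA : IsArtinian A T := isArtinian_of_le hT
  have hTR : IsArtinian R T := isArtinian_of_exists_smul_eq (S := A) fun c z => by
    obtain ⟨r, hr⟩ := exists_smul_eq_of_mem_torsionBySet P c (z : Z) (hTz z z.2)
    exact ⟨r, Subtype.ext hr⟩
  let q : Submodule.torsionBySet R Y P →ₗ[R] T.restrictScalars R :=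
    ((LocalizedModule.mkLinearMap P.primeCompl Y) ∘ₗ Submodule.subtype _).codRestrict _ (by
      rintro ⟨y, hy⟩
      rw [Submodule.mem_torsionBySet_iff] at hy
      change _ ∈ T
      have : IsLocalRing.maximalIdeal A ≤
          LinearMap.ker (LinearMap.toSpanSingleton A Z (LocalizedModule.mk y 1)) := by
        rw [← Localization.AtPrime.map_eq_maximalIdeal, Ideal.map_le_iff_le_comap]
        intro a ha
        have h1 : a • y = 0 := hy ⟨a, ha⟩
        rw [Ideal.mem_comap, LinearMap.mem_ker, LinearMap.toSpanSingleton_apply]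
        rw [algebraMap_smul, LocalizedModule.smul'_mk, h1, LocalizedModule.zero_mk]
      exact (Submodule.mem_torsionBySet_iff _ _).mpr fun a => this a.2)
  have hq : Function.Injective q := by
    rw [← LinearMap.ker_eq_bot, eq_bot_iff]
    rintro ⟨y, hy⟩ hqy
    have h1 : LocalizedModule.mkLinearMap P.primeCompl Y y = 0 := congrArg Subtype.val hqy
    obtain ⟨s, hs⟩ := (IsLocalizedModule.eq_zero_iff P.primeCompl _).mp h1
    obtain ⟨t, b, hb, hts⟩ := hPm.exists_inv s.2
    rw [Submodule.mem_torsionBySet_iff] at hy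
    have h2 : b • y = 0 := hy ⟨b, hb⟩
    refine Subtype.ext ?_
    change y = 0
    rw [← one_smul R y, ← hts, add_smul, h2, mul_smul]
    change t • s • y + 0 = 0
    rw [hs, smul_zero, add_zero]
  have : IsArtinian R (T.restrictScalars R) := hTR
  exact isArtinian_of_injective q hq

end Local

section LocalShift

variable {R : Type u} [CommRing R]

theorem LocalizedModule.mk_mem_range_map {M E : Type*} [AddCommGroup M] [Module R M]
    [AddCommGroup E] [Module R E] (S : Submonoid R) (ι : M →ₗ[R] E) (x : E) (s t : S)
    (h : t • x ∈ LinearMap.range ι) :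
    LocalizedModule.mk x s ∈ LinearMap.range (LocalizedModule.map S ι) := by
  obtain ⟨y, hy⟩ := h
  refine ⟨LocalizedModule.mk y (t * s), ?_⟩
  rw [LocalizedModule.map_mk, hy]
  exact LocalizedModule.mk_cancel_common_left t s x

theorem LocalizedModule.range_map_eq_ker {M E M' : Type*} [AddCommGroup M] [Module R M]
    [AddCommGroup E] [Module R E] [AddCommGroup M'] [Module R M'] (S : Submonoid R)
    {ι : M →ₗ[R] E} {π : E →ₗ[R] M'} (hιπ : LinearMap.range ι = LinearMap.ker π) :
    LinearMap.range (LocalizedModule.map S ι) = LinearMap.ker (LocalizedModule.map S π) := by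
  refine le_antisymm ?_ fun z hz => ?_
  · rintro _ ⟨z, rfl⟩
    induction z using LocalizedModule.induction_on with
    | _ y s =>
      have : π (ι y) = 0 := hιπ.le ⟨y, rfl⟩
      rw [LinearMap.mem_ker, LocalizedModule.map_mk, LocalizedModule.map_mk, this,
        LocalizedModule.zero_mk]
  · induction z using LocalizedModule.induction_on with
    | _ x s =>
      rw [LinearMap.mem_ker, LocalizedModule.map_mk, ← LocalizedModule.zero_mk s,
        LocalizedModule.mk_eq] at hz
      obtain ⟨t, ht⟩ := hz
      refine LocalizedModule.mk_mem_range_map S ι x s (t * s) ?_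
      rw [hιπ, LinearMap.mem_ker, Submonoid.smul_def, map_smul, ← Submonoid.smul_def, mul_smul, ht,
        smul_zero, smul_zero]

variable [IsNoetherianRing R] {M E M' : Type u} [AddCommGroup M] [Module R M] [AddCommGroup E]
  [Module R E] [AddCommGroup M'] [Module R M'] {ι : M →ₗ[R] E} {π : E →ₗ[R] M'}

theorem torsionBySet_le_range_map_of_essential
    (hess : ∀ x : E, x ≠ 0 → ∃ r : R, r • x ≠ 0 ∧ r • x ∈ LinearMap.range ι) (P : Ideal R)
    [P.IsMaximal] (z : LocalizedModule P.primeCompl E)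
    (hz : ∀ a ∈ IsLocalRing.maximalIdeal (Localization.AtPrime P), a • z = 0) :
    z ∈ LinearMap.range (LocalizedModule.map P.primeCompl ι) := by
  induction z using LocalizedModule.induction_on with
  | _ x s =>
    obtain ⟨t, ht, htx⟩ := exists_smul_eq_zero_of_fg P.primeCompl
      (isNoetherianRing_iff_ideal_fg R |>.mp inferInstance P) x fun a ha => by
        have h := hz _ ((IsLocalization.AtPrime.to_map_mem_maximal_iff
          (Localization.AtPrime P) P a).mpr ha)
        rw [algebraMap_smul, LocalizedModule.smul'_mk, ← LocalizedModule.zero_mk s,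
          LocalizedModule.mk_eq] at h
        obtain ⟨t, ht⟩ := h
        refine ⟨t * s, (t * s).2, ?_⟩
        rw [smul_zero, smul_zero, ← mul_smul] at ht
        exact ht
    refine LocalizedModule.mk_mem_range_map P.primeCompl ι x s ⟨t, ht⟩ ?_
    exact torsionBySet_le_range_of_essential hess P
      ((Submodule.mem_torsionBySet_iff _ _).mpr fun a => htx a a.2)

/-- If `E` is an injective hull of `M`, then the Bass numbers of the cokernel are those of `M`,
shifted by one. -/
theorem nonempty_extModule_residueField_linearEquiv (hE : Module.Injective R E)
    (hι : Function.Injective ι)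
    (hess : ∀ x : E, x ≠ 0 → ∃ r : R, r • x ≠ 0 ∧ r • x ∈ LinearMap.range ι)
    (hπ : Function.Surjective π) (hιπ : LinearMap.range ι = LinearMap.ker π) (P : Ideal R)
    [P.IsMaximal] (i : ℕ) :
    Nonempty (extModule (Localization.AtPrime P) (i + 1)
        (IsLocalRing.ResidueField (Localization.AtPrime P)) (LocalizedModule P.primeCompl M)
      ≃ₗ[Localization.AtPrime P] extModule (Localization.AtPrime P) i
        (IsLocalRing.ResidueField (Localization.AtPrime P)) (LocalizedModule P.primeCompl M')) := by
  have hEP : Module.Injective (Localization.AtPrime P) (LocalizedModule P.primeCompl E) :=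
    Module.injective_of_isLocalizedModule P.primeCompl
      (LocalizedModule.mkLinearMap P.primeCompl E)
  have hιP := LocalizedModule.map_injective P.primeCompl ι hι
  have hπP := LocalizedModule.map_surjective P.primeCompl π hπ
  have hιπP := LocalizedModule.range_map_eq_ker P.primeCompl hιπ
  rcases i with _ | n
  · obtain ⟨e₁⟩ := nonempty_extModule_one_linearEquiv hEP hιP hπP hιπP
      (IsLocalRing.ResidueField (Localization.AtPrime P))
    obtain ⟨e₀⟩ := nonempty_extModule_zero_linearEquiv (R := Localization.AtPrime P)
      (IsLocalRing.ResidueField (Localization.AtPrime P)) (LocalizedModule P.primeCompl M')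
    refine ⟨e₁ ≪≫ₗ Submodule.quotEquivOfEqBot _ ?_ ≪≫ₗ e₀.symm⟩
    rw [eq_bot_iff]
    rintro _ ⟨φ, rfl⟩
    refine LinearMap.ext fun c => ?_
    change LocalizedModule.map P.primeCompl π (φ c) = 0
    rw [← LinearMap.mem_ker, ← hιπP]
    refine torsionBySet_le_range_map_of_essential hess P _ fun a ha => ?_
    rw [← map_smul, Algebra.smul_def, IsLocalRing.ResidueField.algebraMap_eq,
      (IsLocalRing.residue_eq_zero_iff a).mpr ha, zero_mul, map_zero]
  · exact nonempty_extModule_succ_linearEquiv hEP hιP hπP hιπP n _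

end LocalShift

section Cosyzygy

variable {R : Type u} [CommRing R]

/-- `Ext^i(-, M)` is the cokernel of `Hom(-, E) → Hom(-, M')` for some `E → M'` supported on
`Supp M` whose socles at the maximal ideals are controlled by the Bass numbers `μ^{i-1}` and
`μ^i` of `M`. -/
theorem exists_extModule_linearEquiv_quotient [IsNoetherianRing R] (i : ℕ) :
    ∀ (M : Type u) [AddCommGroup M] [Module R M],
    ∃ (E M' : Type u) (_ : AddCommGroup E) (_ : Module R E) (_ : AddCommGroup M')
      (_ : Module R M') (f : E →ₗ[R] M'),
      (∀ (X : Type u) [AddCommGroup X] [Module R X], Nonempty (extModule R i X M ≃ₗ[R]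
        ((X →ₗ[R] M') ⧸ LinearMap.range
          (LinearMap.compRight R f : (X →ₗ[R] E) →ₗ[R] X →ₗ[R] M')))) ∧
      Module.support R E ⊆ Module.support R M ∧ Module.support R M' ⊆ Module.support R M ∧
      ∀ (P : Ideal R) [P.IsMaximal], (∀ j : ℕ, (j = i - 1 ∨ j = i) →
        IsFiniteLength (Localization.AtPrime P) (extModule (Localization.AtPrime P) j
          (IsLocalRing.ResidueField (Localization.AtPrime P))
          (LocalizedModule P.primeCompl M))) →
        IsArtinian R (Submodule.torsionBySet R E P) ∧
          IsArtinian R (Submodule.torsionBySet R M' P) := by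
  induction i with
  | zero =>
    intro M _ _
    refine ⟨PUnit, M, inferInstance, inferInstance, inferInstance, inferInstance, 0,
      fun X _ _ => ?_, ?_, subset_rfl, fun P _ h => ⟨inferInstance, ?_⟩⟩
    · obtain ⟨e⟩ := nonempty_extModule_zero_linearEquiv (R := R) X M
      refine ⟨e ≪≫ₗ (Submodule.quotEquivOfEqBot _ ?_).symm⟩
      rw [eq_bot_iff]
      rintro _ ⟨φ, rfl⟩
      exact LinearMap.ext fun x => rfl
    · rw [Module.support_eq_empty]
      exact Set.empty_subset _
    · exact isArtinian_torsionBySet_of_isFiniteLength P M (h 0 (Or.inr rfl))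
  | succ i ih =>
    intro M _ _
    obtain ⟨E, _, _, ι, hE, hι, hess⟩ := exists_injective_hull (R := R) M
    let M' := E ⧸ LinearMap.range ι
    let π : E →ₗ[R] M' := (LinearMap.range ι).mkQ
    have hπ : Function.Surjective π := Submodule.mkQ_surjective _
    have hιπ : LinearMap.range ι = LinearMap.ker π := (Submodule.ker_mkQ _).symm
    have hsE : Module.support R E ⊆ Module.support R M := support_subset_of_essential hess
    have hsM' : Module.support R M' ⊆ Module.support R M :=
      (Module.support_subset_of_surjective π hπ).trans hsE
    rcases i with _ | i
    · refine ⟨E, M', inferInstance, inferInstance, inferInstance, inferInstance, π,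
        fun X _ _ => nonempty_extModule_one_linearEquiv hE hι hπ hιπ X, hsE, hsM',
        fun P _ h => ⟨?_, ?_⟩⟩
      · exact isArtinian_torsionBySet_of_essential hι hess P
          (isArtinian_torsionBySet_of_isFiniteLength P M (h 0 (Or.inl rfl)))
      · obtain ⟨e⟩ := nonempty_extModule_residueField_linearEquiv hE hι hess hπ hιπ P 0
        exact isArtinian_torsionBySet_of_isFiniteLength P M'
          (e.isFiniteLength (h 1 (Or.inr rfl)))
    · obtain ⟨E', M'', _, _, _, _, f, hf, hsE', hsM'', hart⟩ := ih M'
      refine ⟨E', M'', inferInstance, inferInstance, inferInstance, inferInstance, f,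
        fun X _ _ => ?_, hsE'.trans hsM', hsM''.trans hsM', fun P _ h => hart P ?_⟩
      · obtain ⟨e⟩ := nonempty_extModule_succ_linearEquiv hE hι hπ hιπ i X
        obtain ⟨e'⟩ := hf X
        exact ⟨e ≪≫ₗ e'⟩
      · intro j hj
        obtain ⟨e⟩ := nonempty_extModule_residueField_linearEquiv hE hι hess hπ hιπ P j
        exact e.isFiniteLength (h (j + 1) (by omega))

end Cosyzygy

section PowerTorsion

variable {R : Type*} [CommRing R]

theorem isArtinian_torsionBySet_mul {Y : Type*} [AddCommGroup Y] [Module R Y] {I J : Ideal R}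
    (hI : I.FG) (hYI : IsArtinian R (Submodule.torsionBySet R Y I))
    (hYJ : IsArtinian R (Submodule.torsionBySet R Y J)) :
    IsArtinian R (Submodule.torsionBySet R Y (I * J : Ideal R)) := by
  obtain ⟨T, rfl⟩ := hI
  let g : Submodule.torsionBySet R Y (Ideal.span (T : Set R) * J : Ideal R) →ₗ[R]
      T → Submodule.torsionBySet R Y J := LinearMap.pi fun a =>
    ((LinearMap.lsmul R Y (a : R)) ∘ₗ Submodule.subtype _).codRestrict _ fun x => by
      rw [Submodule.mem_torsionBySet_iff]
      intro c
      have := (Submodule.mem_torsionBySet_iff _ _).mp x.2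
        ⟨_, Ideal.mul_mem_mul (Ideal.subset_span a.2) c.2⟩
      change (c : R) • (a : R) • (x : Y) = 0
      rwa [smul_smul, mul_comm]
  have hle : Submodule.torsionBySet R Y (Ideal.span (T : Set R)) ≤
      Submodule.torsionBySet R Y (Ideal.span (T : Set R) * J : Ideal R) :=
    Submodule.torsionBySet_le_torsionBySet_of_subset
      (show Ideal.span (T : Set R) * J ≤ Ideal.span (T : Set R) from Ideal.mul_le_left)
  refine isArtinian_of_range_eq_ker (Submodule.inclusion hle) g ?_
  rw [Submodule.range_inclusion]
  ext x
  rw [Submodule.mem_comap, ← Submodule.torsionBySet_eq_torsionBySet_span,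
    Submodule.mem_torsionBySet_iff, LinearMap.mem_ker]
  constructor
  · exact fun h => funext fun a => Subtype.ext (h a)
  · exact fun h a => congrArg Subtype.val (congrFun h a)

theorem isArtinian_torsionBySet_prod [IsNoetherianRing R] {Y : Type*} [AddCommGroup Y] [Module R Y]
    {ι : Type*} (s : Finset ι) (P : ι → Ideal R)
    (h : ∀ j ∈ s, IsArtinian R (Submodule.torsionBySet R Y (P j))) :
    IsArtinian R (Submodule.torsionBySet R Y (∏ j ∈ s, P j : Ideal R)) := by
  classical
  induction s using Finset.induction_on with
  | empty =>
    have := torsionBySet_pow_zero (D := Y) (⊥ : Ideal R)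
    rw [pow_zero] at this
    rw [Finset.prod_empty, this]
    infer_instance
  | insert j s hj ih =>
    rw [Finset.prod_insert hj]
    exact isArtinian_torsionBySet_mul (isNoetherianRing_iff_ideal_fg R |>.mp inferInstance _)
      (h j (Finset.mem_insert_self _ _)) (ih fun k hk => h k (Finset.mem_insert_of_mem hk))

/-- The `b`-power torsion submodule `Γ_b(Y)`. -/
def powerTorsion (b : Ideal R) (Y : Type*) [AddCommGroup Y] [Module R Y] : Submodule R Y where
  carrier := {x | ∃ n, x ∈ Submodule.torsionBySet R Y (b ^ n : Ideal R)}
  zero_mem' := ⟨0, zero_mem _⟩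
  add_mem' := by
    rintro x y ⟨n, hx⟩ ⟨m, hy⟩
    exact ⟨max n m, add_mem (torsionBySet_pow_mono b (le_max_left n m) hx)
      (torsionBySet_pow_mono b (le_max_right n m) hy)⟩
  smul_mem' := by
    rintro c x ⟨n, hx⟩
    exact ⟨n, Submodule.smul_mem _ c hx⟩

theorem map_mem_powerTorsion (b : Ideal R) {Y Y' : Type*} [AddCommGroup Y] [Module R Y]
    [AddCommGroup Y'] [Module R Y'] (f : Y →ₗ[R] Y') :
    ∀ x ∈ powerTorsion b Y, f x ∈ powerTorsion b Y' := by
  rintro x ⟨n, hx⟩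
  refine ⟨n, ?_⟩
  rw [Submodule.mem_torsionBySet_iff] at hx ⊢
  exact fun a => by rw [← map_smul, hx a, map_zero]

theorem isArtinian_powerTorsion {b : Ideal R} (hb : b.FG) {Y : Type*} [AddCommGroup Y] [Module R Y]
    (h : IsArtinian R (Submodule.torsionBySet R Y b)) : IsArtinian R (powerTorsion b Y) := by
  refine isArtinian_of_torsion hb (fun g => ?_) ?_
  · obtain ⟨n, hn⟩ := g.2
    refine ⟨n, ?_⟩
    rw [Submodule.mem_torsionBySet_iff] at hn ⊢
    exact fun a => Subtype.ext (hn a)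
  · let j : Submodule.torsionBySet R (powerTorsion b Y) b →ₗ[R] Submodule.torsionBySet R Y b :=
      (Submodule.subtype _ ∘ₗ Submodule.subtype _).codRestrict _ fun x => by
        have hx := x.2
        rw [Submodule.mem_torsionBySet_iff] at hx ⊢
        exact fun a => congrArg Subtype.val (hx a)
    refine isArtinian_of_injective j fun x y hxy => ?_
    have : ((x : powerTorsion b Y) : Y) = ((y : powerTorsion b Y) : Y) :=
      congrArg (fun z : Submodule.torsionBySet R Y b => (z : Y)) hxy
    exact Subtype.ext (Subtype.ext this)

theorem isArtinian_linearMap {N Y : Type*} [AddCommGroup N] [Module R N] [Module.Finite R N]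
    [AddCommGroup Y] [Module R Y] [IsArtinian R Y] : IsArtinian R (N →ₗ[R] Y) := by
  obtain ⟨n, s, hs⟩ := Module.Finite.exists_fin (R := R) (M := N)
  let j : (N →ₗ[R] Y) →ₗ[R] Fin n → Y := LinearMap.pi fun k => LinearMap.applyₗ (s k)
  exact isArtinian_of_injective j fun φ ψ h => LinearMap.ext_on_range hs fun k => congrFun h k

theorem mem_powerTorsion_of_support [IsNoetherianRing R] {Y N : Type*} [AddCommGroup Y]
    [Module R Y] [AddCommGroup N] [Module R N] [Module.Finite R N] (I b : Ideal R)
    (hb : ∀ Q ∈ PrimeSpectrum.zeroLocus (I : Set R) ∩ Module.support R Y ∩ Module.support R N,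
      b ≤ Q.asIdeal) (n : ℕ) (φ : (N ⧸ (I ^ n • ⊤ : Submodule R N)) →ₗ[R] Y)
    (x : N ⧸ (I ^ n • ⊤ : Submodule R N)) : φ x ∈ powerTorsion b Y := by
  obtain ⟨v, rfl⟩ := Submodule.mkQ_surjective _ x
  have hrad : b ≤ (Submodule.span R {φ (Submodule.mkQ _ v)}).annihilator.radical := by
    rw [Ideal.radical_eq_sInf]
    refine le_sInf fun Q hQ => ?_
    obtain ⟨hQle, hQp⟩ := hQ
    refine hb ⟨Q, hQp⟩ ⟨⟨?_, Module.mem_support_iff_exists_annihilator.mpr ⟨_, hQle⟩⟩, ?_⟩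
    · refine (PrimeSpectrum.mem_zeroLocus _ _).mpr (hQp.le_of_pow_le (n := n) ?_)
      intro a ha
      refine hQle ?_
      rw [Submodule.mem_annihilator_span_singleton, ← map_smul, ← map_smul]
      have : (I ^ n • ⊤ : Submodule R N).mkQ (a • v) = 0 := by
        rw [Submodule.mkQ_apply, Submodule.Quotient.mk_eq_zero]
        exact Submodule.smul_mem_smul ha trivial
      rw [this, map_zero]
    · rw [Module.support_eq_zeroLocus]
      refine (PrimeSpectrum.mem_zeroLocus _ _).mpr fun a ha => hQle ?_
      rw [Submodule.mem_annihilator_span_singleton, ← map_smul, ← map_smul,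
        Module.mem_annihilator.mp ha v, map_zero, map_zero]
  obtain ⟨k, hk⟩ := Ideal.exists_pow_le_of_le_radical_of_fg hrad
    (isNoetherianRing_iff_ideal_fg R |>.mp inferInstance b)
  exact ⟨k, (Submodule.mem_torsionBySet_iff _ _).mpr fun a =>
    (Submodule.mem_annihilator_span_singleton _ _).mp (hk a.2)⟩

theorem exists_linearEquiv_torsionBySet {N Y : Type*} [AddCommGroup N] [Module R N]
    [AddCommGroup Y] [Module R Y] (J : Ideal R) (W : Submodule R Y)
    (hW : ∀ (φ : (N ⧸ (J • ⊤ : Submodule R N)) →ₗ[R] Y) x, φ x ∈ W) :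
    ∃ e : ((N ⧸ (J • ⊤ : Submodule R N)) →ₗ[R] Y) ≃ₗ[R] Submodule.torsionBySet R (N →ₗ[R] W) J,
      ∀ φ x, (((e φ : N →ₗ[R] W) x : W) : Y) = φ (Submodule.mkQ _ x) := by
  let h : ((N ⧸ (J • ⊤ : Submodule R N)) →ₗ[R] Y) →ₗ[R] Submodule.torsionBySet R (N →ₗ[R] W) J :=
    { toFun := fun φ => ⟨(φ ∘ₗ Submodule.mkQ _).codRestrict W fun x => hW φ _, by
        refine (Submodule.mem_torsionBySet_iff _ _).mpr fun a => LinearMap.ext fun x =>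
          Subtype.ext ?_
        change (a : R) • φ (Submodule.mkQ _ x) = 0
        have : (J • ⊤ : Submodule R N).mkQ ((a : R) • x) = 0 := by
          rw [Submodule.mkQ_apply, Submodule.Quotient.mk_eq_zero]
          exact Submodule.smul_mem_smul a.2 trivial
        rw [← map_smul, ← map_smul, this, map_zero]⟩
      map_add' := fun φ ψ => rfl
      map_smul' := fun c φ => rfl }
  have hh : ∀ φ x, (((h φ : N →ₗ[R] W) x : W) : Y) = φ (Submodule.mkQ _ x) := fun φ x => rfl
  refine ⟨LinearEquiv.ofBijective h ⟨fun φ ψ hφψ => ?_, fun ψ => ?_⟩, hh⟩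
  · refine LinearMap.ext fun x => ?_
    obtain ⟨v, rfl⟩ := Submodule.mkQ_surjective _ x
    rw [← hh, ← hh, hφψ]
  · have hψ : (J • ⊤ : Submodule R N) ≤ LinearMap.ker (W.subtype ∘ₗ (ψ : N →ₗ[R] W)) := by
      refine Submodule.smul_le.mpr fun a ha x _ => ?_
      have := LinearMap.congr_fun ((Submodule.mem_torsionBySet_iff _ _).mp ψ.2 ⟨a, ha⟩) x
      rw [LinearMap.mem_ker, map_smul]
      exact congrArg Subtype.val this
    refine ⟨Submodule.liftQ _ _ hψ, Subtype.ext (LinearMap.ext fun x => Subtype.ext ?_)⟩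
    rw [hh]
    exact Submodule.liftQ_apply _ _ x

theorem relativeLength_torsionBySet_eq_length {N E M' : Type*} [AddCommGroup N] [Module R N]
    [AddCommGroup E] [Module R E] [AddCommGroup M'] [Module R M'] (J : Ideal R) (U : Submodule R E)
    (W : Submodule R M') (f : E →ₗ[R] M') (hf : ∀ x ∈ U, f x ∈ W)
    (hU : ∀ (φ : (N ⧸ (J • ⊤ : Submodule R N)) →ₗ[R] E) x, φ x ∈ U)
    (hW : ∀ (φ : (N ⧸ (J • ⊤ : Submodule R N)) →ₗ[R] M') x, φ x ∈ W) :
    relativeLength ((Submodule.torsionBySet R (N →ₗ[R] U) J).map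
      (LinearMap.compRight R (f.restrict hf) : (N →ₗ[R] U) →ₗ[R] N →ₗ[R] W))
      (Submodule.torsionBySet R (N →ₗ[R] W) J) =
    Module.length R (((N ⧸ (J • ⊤ : Submodule R N)) →ₗ[R] M') ⧸ LinearMap.range
      (LinearMap.compRight R f : ((N ⧸ (J • ⊤ : Submodule R N)) →ₗ[R] E) →ₗ[R]
        (N ⧸ (J • ⊤ : Submodule R N)) →ₗ[R] M')) := by
  obtain ⟨eU, heU⟩ := exists_linearEquiv_torsionBySet J U hU
  obtain ⟨eW, heW⟩ := exists_linearEquiv_torsionBySet J W hW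
  have hcomm : ∀ φ, LinearMap.compRight R (f.restrict hf) (eU φ : N →ₗ[R] U) =
      (eW (f ∘ₗ φ) : N →ₗ[R] W) := by
    refine fun φ => LinearMap.ext fun x => Subtype.ext ?_
    rw [heW]
    exact congrArg f (heU φ x)
  let q := (LinearMap.range
      (LinearMap.compRight R f : ((N ⧸ (J • ⊤ : Submodule R N)) →ₗ[R] E) →ₗ[R]
        (N ⧸ (J • ⊤ : Submodule R N)) →ₗ[R] M')).mkQ
  have hq : Function.Surjective (q ∘ₗ eW.symm.toLinearMap) :=
    (Submodule.mkQ_surjective _).comp eW.symm.surjective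
  rw [relativeLength_eq_length_range (q ∘ₗ eW.symm.toLinearMap) fun ψ => ?_,
    LinearMap.range_eq_top.mpr hq,
    Module.length_top]
  simp only [q, LinearMap.comp_apply, Submodule.mkQ_apply, Submodule.Quotient.mk_eq_zero,
    LinearMap.mem_range]
  constructor
  · rintro ⟨φ, hφ⟩
    refine ⟨eU φ, (eU φ).2, ?_⟩
    have : eW (f ∘ₗ φ) = ψ := (LinearEquiv.eq_symm_apply eW).mp hφ
    rw [hcomm, this]
  · rintro ⟨χ, hχ, hχψ⟩
    refine ⟨eU.symm ⟨χ, hχ⟩, (LinearEquiv.eq_symm_apply eW).mpr (Subtype.ext ?_)⟩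
    change (eW (f ∘ₗ eU.symm ⟨χ, hχ⟩) : N →ₗ[R] W) = ψ
    rw [← hcomm, LinearEquiv.apply_symm_apply]
    exact hχψ

end PowerTorsion

/-- Theorem 5. Let `R` be a commutative Noetherian ring, `I` an ideal,
`N` a finitely generated `R`-module, and `M` an `R`-module (not necessarily finitely
generated) such that `V(I) ∩ Supp(M) ∩ Supp(N)` is a finite set of maximal ideals of `R`.
Fix `i ≥ 0` and assume that for every `m` in this set and every `j ∈ {i-1, i}` (with `j ≥ 0`)
the Bass number `μ^j(m, M)` is finite, i.e. `Ext_{R_m}^j(κ(m), M_m)` is a finite-dimensional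
`κ(m)`-vector space, equivalently a finite-length `R_m`-module.  If `Ext_R^i(N/IⁿN, M)` has
finite length for all `n ≫ 0`, then there is a polynomial `p ∈ ℚ[X]` with
`λ(Ext_R^i(N/IⁿN, M)) = p(n)` for all `n ≫ 0`. -/
theorem stmt_11 {R : Type u} [CommRing R] [IsNoetherianRing R] (I : Ideal R)
    (M N : Type u) [AddCommGroup M] [Module R M]
    [AddCommGroup N] [Module R N] [Module.Finite R N]
    (hSfin : (PrimeSpectrum.zeroLocus (I : Set R) ∩ Module.support R M ∩
      Module.support R N).Finite)
    (hSmax : ∀ P ∈ PrimeSpectrum.zeroLocus (I : Set R) ∩ Module.support R M ∩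
      Module.support R N, P.asIdeal.IsMaximal)
    (i : ℕ)
    (hBass : ∀ P ∈ PrimeSpectrum.zeroLocus (I : Set R) ∩ Module.support R M ∩
        Module.support R N, ∀ j : ℕ, (j = i - 1 ∨ j = i) →
      IsFiniteLength (Localization.AtPrime P.asIdeal)
        (extModule (Localization.AtPrime P.asIdeal) j
          (IsLocalRing.ResidueField (Localization.AtPrime P.asIdeal))
          (LocalizedModule P.asIdeal.primeCompl M)))
    (hfin : ∃ N₀ : ℕ, ∀ n ≥ N₀,
      IsFiniteLength R (extModule R i (N ⧸ (I ^ n • ⊤ : Submodule R N)) M)) :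
    ∃ (p : Polynomial ℚ) (N₀ : ℕ), ∀ n ≥ N₀, ∃ ℓ : ℕ,
      moduleLength R (extModule R i (N ⧸ (I ^ n • ⊤ : Submodule R N)) M) = ℓ ∧
      (ℓ : ℚ) = p.eval (n : ℚ) := by
  obtain ⟨E, M', _, _, _, _, f, hf, hsE, hsM', hart⟩ :=
    exists_extModule_linearEquiv_quotient (R := R) i M
  let b : Ideal R := ∏ P ∈ hSfin.toFinset, P.asIdeal
  have hbfg : b.FG := isNoetherianRing_iff_ideal_fg R |>.mp inferInstance b
  have hb : ∀ (Y : Type u) [AddCommGroup Y] [Module R Y],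
      Module.support R Y ⊆ Module.support R M → ∀ Q ∈ PrimeSpectrum.zeroLocus (I : Set R) ∩
        Module.support R Y ∩ Module.support R N, b ≤ Q.asIdeal := by
    intro Y _ _ hY Q hQ
    exact Ideal.le_of_dvd (Finset.dvd_prod_of_mem _
      (hSfin.mem_toFinset.mpr ⟨⟨hQ.1.1, hY hQ.1.2⟩, hQ.2⟩))
  have hartS : ∀ P ∈ hSfin.toFinset, IsArtinian R (Submodule.torsionBySet R E P.asIdeal) ∧
      IsArtinian R (Submodule.torsionBySet R M' P.asIdeal) := by
    intro P hP
    have hPS := hSfin.mem_toFinset.mp hP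
    have := hSmax P hPS
    exact hart P.asIdeal (hBass P hPS)
  have hΓE : IsArtinian R (powerTorsion b E) := isArtinian_powerTorsion hbfg
    (isArtinian_torsionBySet_prod _ _ fun P hP => (hartS P hP).1)
  have hΓM' : IsArtinian R (powerTorsion b M') := isArtinian_powerTorsion hbfg
    (isArtinian_torsionBySet_prod _ _ fun P hP => (hartS P hP).2)
  have hDE : IsArtinian R (N →ₗ[R] powerTorsion b E) := isArtinian_linearMap
  have hDM' : IsArtinian R (N →ₗ[R] powerTorsion b M') := isArtinian_linearMap
  have hlen : ∀ n, relativeLength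
      ((Submodule.torsionBySet R (N →ₗ[R] powerTorsion b E) (I ^ n : Ideal R)).map
        (LinearMap.compRight R (f.restrict (map_mem_powerTorsion b f)) :
          (N →ₗ[R] powerTorsion b E) →ₗ[R] N →ₗ[R] powerTorsion b M'))
      (Submodule.torsionBySet R (N →ₗ[R] powerTorsion b M') (I ^ n : Ideal R)) =
      Module.length R (extModule R i (N ⧸ (I ^ n • ⊤ : Submodule R N)) M) := by
    intro n
    obtain ⟨e⟩ := hf (N ⧸ (I ^ n • ⊤ : Submodule R N))
    rw [e.length_eq]
    exact relativeLength_torsionBySet_eq_length _ _ _ f _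
      (mem_powerTorsion_of_support I b (hb E hsE) n)
      (mem_powerTorsion_of_support I b (hb M' hsM') n)
  obtain ⟨N₀, hN₀⟩ := hfin
  obtain ⟨p, N₁, hp⟩ := isEventuallyPolynomial_torsionBySet
    (isNoetherianRing_iff_ideal_fg R |>.mp inferInstance I)
    (LinearMap.compRight R (f.restrict (map_mem_powerTorsion b f)) :
      (N →ₗ[R] powerTorsion b E) →ₗ[R] N →ₗ[R] powerTorsion b M')
    ⟨N₀, fun n hn => by
      rw [hlen]
      exact Module.length_ne_top_iff.mpr (hN₀ n hn)⟩
  refine ⟨p, N₁, fun n hn => ?_⟩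
  obtain ⟨l, hl, hlp⟩ := hp n hn
  refine ⟨l, ?_, hlp⟩
  beta_reduce at hl
  rw [hlen] at hl
  rw [moduleLength, ← Module.coe_length, hl]
  rfl
end
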